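/- Adopt the setup of the weakly coupled system: Ω = ℝⁿ₊; B_∥ locally Lipschitz, uniformly elliptic (λ,Λ), Lu = div_∥(B_∥∇_∥u) + ∂²_t u; M = max( Carleson norm of |∇_x B_∥|² t dx dt , sup (t|∇_x B_∥|)² ) finite; ∇_x f ∈ L²(ℝ^{n-1}); v_m energy solutions of Lv_m = 0 with traces ∂_m f, V = (v₁,…,v_{n-1}); η = (η₁,…,η_{n-1}) the weak solution with zero trace of L η_m = Σ_{i,j<n} ∂_i((∂_m b_{ij})(v_j + η_j)). Assume moreover the L² Dirichlet problem for L is solvable with constant C_D (so ‖N(v_m)‖_{L²} ≤ C_D ‖∂_m f‖_{L²}). Then there is a constant C = C(n,λ,Λ,C_D, apertures) such that Σ_{m<n} ‖S(η_m)‖²_{L²(ℝ^{n-1})} ≤ C·M·( ‖∇_x f‖²_{L²(ℝ^{n-1})} + Σ_{m<n} ‖N(η_m)‖²_{L²(ℝ^{n-1})} ). In particular the coefficient of the right-hand side tends to 0 as M → 0. -/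

import Mathlib

open MeasureTheory Set Filter
open scoped ENNReal NNReal

noncomputable section

/-! ## Basic geometry of the upper half-space `ℝⁿ₊ = ℝ^{n-1} × (0,∞)` -/

abbrev EE (n : ℕ) := EuclideanSpace ℝ (Fin (n - 1))
abbrev Pt (n : ℕ) := EE n × ℝ

/-- The upper half-space `ℝⁿ₊`. -/
def UHS (n : ℕ) : Set (Pt n) := {X | 0 < X.2}

/-- Euclidean distance on `ℝ^{n-1} × ℝ`. -/
def dist2 {n : ℕ} (X Y : Pt n) : ℝ := Real.sqrt (dist X.1 Y.1 ^ 2 + (X.2 - Y.2) ^ 2)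

/-- Euclidean ball in `ℝ^{n-1} × ℝ`. -/
def ball2 {n : ℕ} (X : Pt n) (r : ℝ) : Set (Pt n) := {Y | dist2 Y X < r}

/-- Whitney ball `B(X, δ(X)/2)` for the upper half-space (`δ(X) = t`). -/
def wball {n : ℕ} (X : Pt n) : Set (Pt n) := ball2 X (X.2 / 2)

/-- Nontangential cone of aperture `a` with vertex `q ∈ ℝ^{n-1} = ∂ℝⁿ₊`. -/
def cone {n : ℕ} (a : ℝ) (q : EE n) : Set (Pt n) :=
  {X | 0 < X.2 ∧ dist2 X (q, 0) ≤ (1 + a) * X.2}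

/-- Cone truncated at height `h`. -/
def coneTrunc {n : ℕ} (a h : ℝ) (q : EE n) : Set (Pt n) := cone a q ∩ {X | X.2 < h}

/-- Doubly truncated cone `Γ_ε(q)`. -/
def coneEps {n : ℕ} (a ε : ℝ) (q : EE n) : Set (Pt n) :=
  cone a q ∩ {X | ε < X.2 ∧ X.2 < 1 / ε}

/-! ## Derivatives -/

/-- The `i`-th coordinate direction in `ℝ^{n-1} × ℝ`. -/
def bvec (n : ℕ) (i : Fin n) : Pt n :=
  if h : (i : ℕ) < n - 1 then (EuclideanSpace.single (⟨i, h⟩ : Fin (n - 1)) 1, 0)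
  else ((0 : EE n), 1)

/-- Partial derivative of `u` in the `i`-th coordinate direction. -/
def pd {n : ℕ} (i : Fin n) (u : Pt n → ℝ) (X : Pt n) : ℝ := fderiv ℝ u X (bvec n i)

/-- Horizontal partial derivative. -/
def pdx {n : ℕ} (i : Fin (n - 1)) (u : Pt n → ℝ) (X : Pt n) : ℝ :=
  fderiv ℝ u X (EuclideanSpace.single i 1, 0)

/-- Vertical partial derivative `∂_t`. -/
def pdt {n : ℕ} (u : Pt n → ℝ) (X : Pt n) : ℝ := fderiv ℝ u X (0, 1)

/-- Squared length of the full gradient of `u`. -/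
def gradSq {n : ℕ} (u : Pt n → ℝ) (X : Pt n) : ℝ := ∑ i : Fin n, pd i u X ^ 2

/-- Squared length of the horizontal gradient of `u`. -/
def gradxSq {n : ℕ} (u : Pt n → ℝ) (X : Pt n) : ℝ := ∑ i : Fin (n - 1), pdx i u X ^ 2

/-- Squared Hilbert–Schmidt norm of the Hessian of `u`. -/
def hessSq {n : ℕ} (u : Pt n → ℝ) (X : Pt n) : ℝ :=
  ∑ i : Fin n, ∑ j : Fin n, pd i (pd j u) X ^ 2

/-- Partial derivative of a function on the boundary `ℝ^{n-1}` (or `ℝ^d`). -/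
def pdE {d : ℕ} (i : Fin d) (f : EuclideanSpace ℝ (Fin d) → ℝ)
    (q : EuclideanSpace ℝ (Fin d)) : ℝ :=
  fderiv ℝ f q (EuclideanSpace.single i 1)

/-- Squared length of the gradient of a boundary function. -/
def gradSqE {d : ℕ} (f : EuclideanSpace ℝ (Fin d) → ℝ) (q : EuclideanSpace ℝ (Fin d)) : ℝ :=
  ∑ i, pdE i f q ^ 2

/-- Frobenius norm of an `m × m` matrix. -/
def mnorm {m : ℕ} (M : Fin m → Fin m → ℝ) : ℝ := Real.sqrt (∑ p, ∑ q, M p q ^ 2)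

/-- Norm of the full gradient of a matrix-valued function. -/
def gradA {n m : ℕ} (A : Pt n → Fin m → Fin m → ℝ) (X : Pt n) : ℝ :=
  Real.sqrt (∑ p, ∑ q, gradSq (fun Y => A Y p q) X)

/-- Norm of the horizontal gradient of a matrix-valued function. -/
def gradxA {n m : ℕ} (A : Pt n → Fin m → Fin m → ℝ) (X : Pt n) : ℝ :=
  Real.sqrt (∑ p, ∑ q, gradxSq (fun Y => A Y p q) X)

/-! ## Nontangential maximal functions, square functions, norms -/

/-- Nontangential maximal function. -/
def NT {n : ℕ} (a : ℝ) (F : Pt n → ℝ) (q : EE n) : ℝ≥0∞ :=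
  ⨆ X ∈ cone a q, ENNReal.ofReal |F X|

/-- Nontangential maximal function of a vector-valued function. -/
def NTv {n m : ℕ} (a : ℝ) (w : Fin m → Pt n → ℝ) (q : EE n) : ℝ≥0∞ :=
  ⨆ X ∈ cone a q, ENNReal.ofReal (Real.sqrt (∑ k, w k X ^ 2))

/-- `L²`-averaged nontangential maximal function `Ñ`, applied to the *squared*
density `G` (e.g. `G = |∇u|²`). -/
def NTav {n : ℕ} (a : ℝ) (G : Pt n → ℝ) (q : EE n) : ℝ≥0∞ :=
  ⨆ X ∈ cone a q,
    ((volume (wball X))⁻¹ * ∫⁻ Y in wball X, ENNReal.ofReal (G Y)) ^ (1 / 2 : ℝ)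

/-- Truncated version of `NTav` (cones truncated at height `h`). -/
def NTavTr {n : ℕ} (a h : ℝ) (G : Pt n → ℝ) (q : EE n) : ℝ≥0∞ :=
  ⨆ X ∈ coneTrunc a h q,
    ((volume (wball X))⁻¹ * ∫⁻ Y in wball X, ENNReal.ofReal (G Y)) ^ (1 / 2 : ℝ)

/-- `L¹`-averaged nontangential maximal function, over a general family `Γ` of points. -/
def NT1on {n : ℕ} (Γ : Set (Pt n)) (F : Pt n → ℝ) : ℝ≥0∞ :=
  ⨆ X ∈ Γ, (volume (wball X))⁻¹ * ∫⁻ Y in wball X, ENNReal.ofReal |F Y|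

/-- Square function over a region `Γ`, applied to the *squared* density `G = |∇v|²`. -/
def SFon {n : ℕ} (Γ : Set (Pt n)) (G : Pt n → ℝ) : ℝ≥0∞ :=
  (∫⁻ X in Γ, ENNReal.ofReal (G X) * ENNReal.ofReal (X.2 ^ ((2 : ℝ) - n))) ^ (1 / 2 : ℝ)

/-- Square function with aperture `a`, applied to the squared density `G = |∇v|²`. -/
def SF {n : ℕ} (a : ℝ) (G : Pt n → ℝ) (q : EE n) : ℝ≥0∞ := SFon (cone a q) G

/-- `L^p` (quasi-)norm over `ℝ^{n-1}` of an `ℝ≥0∞`-valued function. -/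
def bLp {d : ℕ} (p : ℝ) (g : EuclideanSpace ℝ (Fin d) → ℝ≥0∞) : ℝ≥0∞ :=
  (∫⁻ q, g q ^ p) ^ (1 / p)

/-- `L^p` (quasi-)norm over a subset `S ⊆ ℝ^{n-1}`. -/
def bLpOn {d : ℕ} (p : ℝ) (S : Set (EuclideanSpace ℝ (Fin d)))
    (g : EuclideanSpace ℝ (Fin d) → ℝ≥0∞) : ℝ≥0∞ :=
  (∫⁻ q in S, g q ^ p) ^ (1 / p)

/-- Localized Hardy–Littlewood maximal function, over balls contained in `R`. -/
def MHL {d : ℕ} (R : Set (EuclideanSpace ℝ (Fin d))) (g : EuclideanSpace ℝ (Fin d) → ℝ≥0∞)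
    (x : EuclideanSpace ℝ (Fin d)) : ℝ≥0∞ :=
  ⨆ (z : EuclideanSpace ℝ (Fin d)) (ρ : ℝ) (_ : 0 < ρ) (_ : x ∈ Metric.ball z ρ)
      (_ : Metric.ball z ρ ⊆ R),
    (volume (Metric.ball z ρ))⁻¹ * ∫⁻ y in Metric.ball z ρ, g y

/-! ## Carleson measures on the half-space -/

/-- `μ` is a Carleson measure on `ℝⁿ₊` with norm at most `K`. -/
def CarlNormLE {n : ℕ} (μ : Measure (Pt n)) (K : ℝ) : Prop :=
  ∀ (q : EE n) (r : ℝ), 0 < r →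
    μ (Metric.ball q r ×ˢ Ioo 0 r) ≤ ENNReal.ofReal K * volume (Metric.ball q r)

/-- `μ` is a Carleson measure on `ℝⁿ₊`. -/
def IsCarleson {n : ℕ} (μ : Measure (Pt n)) : Prop := ∃ K : ℝ, 0 ≤ K ∧ CarlNormLE μ K

/-- The measure with density `g` with respect to Lebesgue measure. -/
def densM {n : ℕ} (g : Pt n → ℝ≥0∞) : Measure (Pt n) := volume.withDensity g

/-! ## Ellipticity, weak solutions, solvability (half-space) -/

/-- Uniform ellipticity of an `m × m` matrix-valued function on `Ω`. -/
def EllipticOn {n m : ℕ} (Ω : Set (Pt n)) (A : Pt n → Fin m → Fin m → ℝ)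
    (lam Lam : ℝ) : Prop :=
  ∀ X ∈ Ω,
    (∀ ξ : Fin m → ℝ, lam * ∑ i, ξ i ^ 2 ≤ ∑ i, ∑ j, A X i j * ξ j * ξ i) ∧
    (∀ ξ η : Fin m → ℝ, |∑ i, ∑ j, A X i j * ξ j * η i| ≤
      Lam * Real.sqrt (∑ i, ξ i ^ 2) * Real.sqrt (∑ i, η i ^ 2))

/-- Smooth compactly supported test function with support in `Ω`. -/
def TestFun {n : ℕ} (Ω : Set (Pt n)) (ϕ : Pt n → ℝ) : Prop :=
  ContDiff ℝ (⊤ : ℕ∞) ϕ ∧ HasCompactSupport ϕ ∧ tsupport ϕ ⊆ Ω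

/-- Weak solution of `div(A∇u)=0` in `ℝⁿ₊`. -/
def WeakSolution {n : ℕ} (A : Pt n → Fin n → Fin n → ℝ) (u : Pt n → ℝ) : Prop :=
  (∀ X ∈ UHS n, DifferentiableAt ℝ u X) ∧
  ∀ ϕ : Pt n → ℝ, TestFun (UHS n) ϕ →
    (∫ X in UHS n, ∑ i, ∑ j, A X i j * pd j u X * pd i ϕ X) = 0

/-- Finite Dirichlet energy: `u ∈ Ẇ^{1,2}(ℝⁿ₊)`. -/
def FiniteEnergy {n : ℕ} (u : Pt n → ℝ) : Prop :=
  (∫⁻ X in UHS n, ENNReal.ofReal (gradSq u X)) < ⊤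

/-- `u` has (vertical nontangential) boundary trace `f`. -/
def HasTrace {n : ℕ} (u : Pt n → ℝ) (f : EE n → ℝ) : Prop :=
  ∀ q : EE n, Tendsto (fun t : ℝ => u (q, t)) (nhdsWithin 0 (Ioi 0)) (nhds (f q))

/-- Energy solution of the Dirichlet problem with data `f`. -/
def EnergySolution {n : ℕ} (A : Pt n → Fin n → Fin n → ℝ) (u : Pt n → ℝ)
    (f : EE n → ℝ) : Prop :=
  WeakSolution A u ∧ FiniteEnergy u ∧ HasTrace u f

/-- Solvability of the `L^p` Dirichlet problem in `ℝⁿ₊`. -/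
def DirichletSolvable {n : ℕ} (A : Pt n → Fin n → Fin n → ℝ) (p : ℝ) : Prop :=
  ∃ C : ℝ, 0 < C ∧ ∀ u f, EnergySolution A u f →
    bLp p (NT 1 u) ≤ ENNReal.ofReal C * bLp p (fun q => ENNReal.ofReal |f q|)

/-- Solvability of the `L^p` Regularity problem in `ℝⁿ₊`. -/
def RegularitySolvable {n : ℕ} (A : Pt n → Fin n → Fin n → ℝ) (p : ℝ) : Prop :=
  ∃ C : ℝ, 0 < C ∧ ∀ u f, EnergySolution A u f → (∀ q, DifferentiableAt ℝ f q) →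
    bLp p (NTav 1 (gradSq u)) ≤
      ENNReal.ofReal C * bLp p (fun q => ENNReal.ofReal (gradSqE f q) ^ (1 / 2 : ℝ))

/-- The `n × n` block matrix built from an `(n-1) × (n-1)` matrix `A_∥`. -/
def blockOf {n : ℕ} (Apar : Pt n → Fin (n - 1) → Fin (n - 1) → ℝ) (X : Pt n)
    (i j : Fin n) : ℝ :=
  if h : (i : ℕ) < n - 1 ∧ (j : ℕ) < n - 1 then Apar X ⟨i, h.1⟩ ⟨j, h.2⟩
  else if (i : ℕ) = (j : ℕ) then 1 else 0

/-- The upper-left `(n-1) × (n-1)` block `A_∥` of an `n × n` matrix. -/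
def parOf {n : ℕ} (A : Pt n → Fin n → Fin n → ℝ) (X : Pt n)
    (i j : Fin (n - 1)) : ℝ :=
  A X (Fin.castLE (Nat.sub_le n 1) i) (Fin.castLE (Nat.sub_le n 1) j)

/-- Transpose of a matrix-valued function. -/
def transp {n m : ℕ} (A : Pt n → Fin m → Fin m → ℝ) : Pt n → Fin m → Fin m → ℝ :=
  fun X i j => A X j i

/-! ## Lipschitz graph domains -/

/-- The domain above the graph of `φ`. -/
def gdom {n : ℕ} (φ : EE n → ℝ) : Set (Pt n) := {X | φ X.1 < X.2}

/-- Distance to the boundary (the graph of `φ`). -/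
def gdist {n : ℕ} (φ : EE n → ℝ) (X : Pt n) : ℝ := ⨅ q : EE n, dist2 X (q, φ q)

/-- Whitney ball in a graph domain. -/
def gwball {n : ℕ} (φ : EE n → ℝ) (X : Pt n) : Set (Pt n) := ball2 X (gdist φ X / 2)

/-- Nontangential cone at the boundary point `(q, φ q)`. -/
def gcone {n : ℕ} (φ : EE n → ℝ) (a : ℝ) (q : EE n) : Set (Pt n) :=
  {X | X ∈ gdom φ ∧ dist2 X (q, φ q) ≤ (1 + a) * gdist φ X}

/-- Truncated cone in a graph domain. -/
def gconeTrunc {n : ℕ} (φ : EE n → ℝ) (a h : ℝ) (q : EE n) : Set (Pt n) :=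
  gcone φ a q ∩ {X | dist2 X (q, φ q) < h}

/-- Nontangential maximal function in a graph domain. -/
def gNT {n : ℕ} (φ : EE n → ℝ) (a : ℝ) (F : Pt n → ℝ) (q : EE n) : ℝ≥0∞ :=
  ⨆ X ∈ gcone φ a q, ENNReal.ofReal |F X|

/-- Truncated nontangential maximal function of a vector-valued function. -/
def gNTvTr {n m : ℕ} (φ : EE n → ℝ) (a h : ℝ) (w : Fin m → Pt n → ℝ) (q : EE n) : ℝ≥0∞ :=
  ⨆ X ∈ gconeTrunc φ a h q, ENNReal.ofReal (Real.sqrt (∑ k, w k X ^ 2))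

/-- `L²`-averaged nontangential maximal function in a graph domain,
applied to the squared density `G`. -/
def gNTav {n : ℕ} (φ : EE n → ℝ) (a : ℝ) (G : Pt n → ℝ) (q : EE n) : ℝ≥0∞ :=
  ⨆ X ∈ gcone φ a q,
    ((volume (gwball φ X))⁻¹ * ∫⁻ Y in gwball φ X, ENNReal.ofReal (G Y)) ^ (1 / 2 : ℝ)

/-- Square function over a region in a graph domain (squared density `G`). -/
def gSFon {n : ℕ} (φ : EE n → ℝ) (Γ : Set (Pt n)) (G : Pt n → ℝ) : ℝ≥0∞ :=
  (∫⁻ X in Γ, ENNReal.ofReal (G X) * ENNReal.ofReal (gdist φ X ^ ((2 : ℝ) - n))) ^ (1 / 2 : ℝ)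

/-- Carleson measure condition in a graph domain (surface measure of a boundary
ball of radius `r` is comparable to `r^{n-1}`). -/
def gCarlNormLE {n : ℕ} (φ : EE n → ℝ) (μ : Measure (Pt n)) (K : ℝ) : Prop :=
  ∀ (q : EE n) (r : ℝ), 0 < r →
    μ (ball2 (q, φ q) r ∩ gdom φ) ≤ ENNReal.ofReal (K * r ^ (n - 1))

def gIsCarleson {n : ℕ} (φ : EE n → ℝ) (μ : Measure (Pt n)) : Prop :=
  ∃ K : ℝ, 0 ≤ K ∧ gCarlNormLE φ μ K

/-- The density of the oscillation Carleson measure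
`δ(X)^{-1} [sup_{Y,Z ∈ B(X,δ(X)/2)} |A(Y) - A(Z)|]²`. -/
def oscDens {n : ℕ} (φ : EE n → ℝ) (A : Pt n → Fin n → Fin n → ℝ) (X : Pt n) : ℝ≥0∞ :=
  (ENNReal.ofReal (gdist φ X))⁻¹ *
    (⨆ Y ∈ gwball φ X, ⨆ Z ∈ gwball φ X,
        ENNReal.ofReal (mnorm fun p q => A Y p q - A Z p q)) ^ 2

/-- `u` has boundary trace `f` on the graph (vertical nontangential limits). -/
def gHasTrace {n : ℕ} (φ : EE n → ℝ) (u : Pt n → ℝ) (f : EE n → ℝ) : Prop :=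
  ∀ q : EE n, Tendsto (fun t : ℝ => u (q, φ q + t)) (nhdsWithin 0 (Ioi 0)) (nhds (f q))

/-- Weak solution of `div(A∇u)=0` in the graph domain. -/
def gWeakSolution {n : ℕ} (φ : EE n → ℝ) (A : Pt n → Fin n → Fin n → ℝ)
    (u : Pt n → ℝ) : Prop :=
  (∀ X ∈ gdom φ, DifferentiableAt ℝ u X) ∧
  ∀ ϕ : Pt n → ℝ, TestFun (gdom φ) ϕ →
    (∫ X in gdom φ, ∑ i, ∑ j, A X i j * pd j u X * pd i ϕ X) = 0

def gFiniteEnergy {n : ℕ} (φ : EE n → ℝ) (u : Pt n → ℝ) : Prop :=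
  (∫⁻ X in gdom φ, ENNReal.ofReal (gradSq u X)) < ⊤

def gEnergySolution {n : ℕ} (φ : EE n → ℝ) (A : Pt n → Fin n → Fin n → ℝ)
    (u : Pt n → ℝ) (f : EE n → ℝ) : Prop :=
  gWeakSolution φ A u ∧ gFiniteEnergy φ u ∧ gHasTrace φ u f

/-- Solvability of the `L^p` Dirichlet problem in the graph domain. -/
def gDirichletSolvable {n : ℕ} (φ : EE n → ℝ) (A : Pt n → Fin n → Fin n → ℝ)
    (p : ℝ) : Prop :=
  ∃ C : ℝ, 0 < C ∧ ∀ u f, gEnergySolution φ A u f →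
    bLp p (gNT φ 1 u) ≤ ENNReal.ofReal C * bLp p (fun q => ENNReal.ofReal |f q|)

/-- Solvability of the `L^p` Regularity problem in the graph domain; the boundary
datum is identified with a function `f` of `x ∈ ℝ^{n-1}`, and `∇_T f` with `∇_x f`. -/
def gRegularitySolvable {n : ℕ} (φ : EE n → ℝ) (A : Pt n → Fin n → Fin n → ℝ)
    (p : ℝ) : Prop :=
  ∃ C : ℝ, 0 < C ∧ ∀ u f, gEnergySolution φ A u f → (∀ q, DifferentiableAt ℝ f q) →
    bLp p (gNTav φ 1 (gradSq u)) ≤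
      ENNReal.ofReal C * bLp p (fun q => ENNReal.ofReal (gradSqE f q) ^ (1 / 2 : ℝ))

/-- Solvability of the `L^p` Neumann problem in the graph domain. The co-normal
data `f` is identified with a function of `x ∈ ℝ^{n-1}`. -/
def gNeumannSolvable {n : ℕ} (φ : EE n → ℝ) (A : Pt n → Fin n → Fin n → ℝ)
    (p : ℝ) : Prop :=
  ∃ C : ℝ, 0 < C ∧ ∀ (u : Pt n → ℝ) (f : EE n → ℝ),
    (∀ X ∈ gdom φ, DifferentiableAt ℝ u X) → gFiniteEnergy φ u →
    Integrable f → (∫ q, f q) = 0 →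
    (∀ η : Pt n → ℝ, ContDiff ℝ (⊤ : ℕ∞) η → HasCompactSupport η →
      (∫ X in gdom φ, ∑ i, ∑ j, A X i j * pd j u X * pd i η X) = ∫ q, f q * η (q, φ q)) →
    bLp p (gNTav φ 1 (gradSq u)) ≤ ENNReal.ofReal C * bLp p (fun q => ENNReal.ofReal |f q|)

/-! ## The weakly coupled system of Section 5 -/

/-- The common setup for the weakly coupled system: `B_∥` satisfies the Carleson
condition with constant `M`, the `v_m` are energy solutions of the block-form
operator with data `∂_m f`, and `η` solves the weakly coupled system with zero
boundary data. -/
def WCSetup {n : ℕ} (Bpar : Pt n → Fin (n - 1) → Fin (n - 1) → ℝ) (M : ℝ)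
    (f : EE n → ℝ) (v η : Fin (n - 1) → Pt n → ℝ) : Prop :=
  LocallyLipschitz Bpar ∧
  CarlNormLE (densM fun X => ENNReal.ofReal (gradxA Bpar X ^ 2 * X.2)) M ∧
  (∀ X ∈ UHS n, (X.2 * gradxA Bpar X) ^ 2 ≤ M) ∧
  (∫⁻ q, ENNReal.ofReal (gradSqE f q)) < ⊤ ∧
  (∀ q, DifferentiableAt ℝ f q) ∧
  (∀ m : Fin (n - 1), EnergySolution (blockOf Bpar) (v m) (fun q => pdE m f q)) ∧
  (∀ m : Fin (n - 1),
    (∀ X ∈ UHS n, DifferentiableAt ℝ (η m) X) ∧ FiniteEnergy (η m) ∧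
    HasTrace (η m) (fun _ => 0) ∧
    ∀ ϕ : Pt n → ℝ, TestFun (UHS n) ϕ →
      (∫ X in UHS n, (∑ i : Fin (n - 1), ∑ j : Fin (n - 1),
          Bpar X i j * pdx j (η m) X * pdx i ϕ X) + pdt (η m) X * pdt ϕ X) =
        -∫ X in UHS n, ∑ i : Fin (n - 1), ∑ j : Fin (n - 1),
            pdx m (fun Z => Bpar Z i j) X * (v j X + η j X) * pdx i ϕ X)



lemma ext_contOn {u u' : ℝ → ℝ} (hd : ∀ t, 0 < t → HasDerivAt u (u' t) t)
    (ht : Tendsto u (nhdsWithin 0 (Ioi 0)) (nhds 0)) :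
    Continuous (fun t => if 0 < t then u t else 0) := by
  rw [continuous_iff_continuousAt]
  intro t
  rcases lt_trichotomy t 0 with h | h | h
  · have : (fun t => if 0 < t then u t else 0) =ᶠ[nhds t] fun _ => 0 := by
      filter_upwards [Iio_mem_nhds h] with s hs
      rw [if_neg (not_lt.2 (le_of_lt hs))]
    exact continuousAt_const.congr this.symm
  · subst h
    rw [continuousAt_iff_continuous_left_right]
    constructor
    · apply ContinuousWithinAt.congr (f := fun _ => (0:ℝ)) continuousWithinAt_const
      · intro y hy; rw [if_neg (not_lt.2 hy)]
      · simp
    · rw [← continuousWithinAt_Ioi_iff_Ici]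
      unfold ContinuousWithinAt
      simp only [lt_irrefl, if_false]
      refine ht.congr' ?_
      filter_upwards [self_mem_nhdsWithin] with s hs
      rw [if_pos (mem_Ioi.1 hs)]
  · have : (fun t => if 0 < t then u t else 0) =ᶠ[nhds t] u := by
      filter_upwards [Ioi_mem_nhds h] with s hs
      rw [if_pos (mem_Ioi.1 hs)]
    exact (hd t h).continuousAt.congr this.symm

lemma ext_deriv {u u' : ℝ → ℝ} (hd : ∀ t, 0 < t → HasDerivAt u (u' t) t) {t : ℝ} (h : 0 < t) :
    HasDerivAt (fun t => if 0 < t then u t else 0) (u' t) t := by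
  refine (hd t h).congr_of_eventuallyEq ?_
  filter_upwards [Ioi_mem_nhds h] with s hs
  rw [if_pos (mem_Ioi.1 hs)]

lemma hardy_aux {U u' : ℝ → ℝ} (hc : Continuous U) (h0 : U 0 = 0)
    (hd : ∀ t, 0 < t → HasDerivAt U (u' t) t)
    (hi : IntegrableOn (fun t => u' t ^ 2) (Ioi 0)) (ε T : ℝ) (hε : 0 < ε) (hT : 0 < T) :
    ∫ t in (0:ℝ)..T, U t ^ 2 / (t + ε) ^ 2 ≤ 4 * ∫ t in (0:ℝ)..T, u' t ^ 2 := by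
  have hcont : ContinuousOn (fun t => U t ^ 2 / (t + ε) ^ 2) (Icc 0 T) := by
    apply ContinuousOn.div (by fun_prop) (by fun_prop)
    intro t ht
    have := ht.1
    positivity
  have hint1 : IntegrableOn (fun t => U t ^ 2 / (t + ε) ^ 2) (Icc 0 T) :=
    hcont.integrableOn_Icc
  have hint2 : IntegrableOn (fun t => u' t ^ 2) (Icc 0 T) := by
    rw [integrableOn_Icc_iff_integrableOn_Ioc]
    exact hi.mono_set Ioc_subset_Ioi_self
  have key := intervalIntegral.integral_le_sub_of_hasDeriv_right_of_le (a := 0) (b := T)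
    (g := fun t => - (U t ^ 2 / (t + ε)))
    (g' := fun t => - ((2 * U t * u' t * (t + ε) - U t ^ 2 * 1) / (t + ε) ^ 2))
    (φ := fun t => 1/2 * (U t ^ 2 / (t + ε) ^ 2) - 2 * u' t ^ 2) hT.le
    (by
      apply ContinuousOn.neg
      apply ContinuousOn.div (by fun_prop) (by fun_prop)
      intro t ht
      have := ht.1
      positivity)
    (by
      intro t ht
      have h1 := hd t ht.1
      have : t + ε ≠ 0 := by have := ht.1; positivity
      have h2 := ((h1.pow 2).div ((hasDerivAt_id t).add_const ε) this).neg
      refine (HasDerivAt.congr_deriv h2 ?_).hasDerivWithinAt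
      simp)
    (by exact (hint1.const_mul (1/2)).sub (hint2.const_mul 2))
    (by
      intro t ht
      have h3 : 0 < t + ε := by have := ht.1; positivity
      have : (-((2 * U t * u' t * (t + ε) - U t ^ 2 * 1) / (t + ε) ^ 2)) -
        (1/2 * (U t ^ 2 / (t + ε) ^ 2) - 2 * u' t ^ 2) = 1/2 * (U t / (t+ε) - 2 * u' t)^2 := by
        field_simp; ring
      nlinarith [sq_nonneg (U t / (t+ε) - 2 * u' t)])
  rw [intervalIntegral.integral_sub, intervalIntegral.integral_const_mul,
    intervalIntegral.integral_const_mul] at key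
  · have : 0 ≤ U T ^ 2 / (T + ε) := by positivity
    simp only [h0] at key
    norm_num at key
    linarith
  · rw [intervalIntegrable_iff_integrableOn_Icc_of_le hT.le]; exact hint1.const_mul _
  · rw [intervalIntegrable_iff_integrableOn_Icc_of_le hT.le]; exact hint2.const_mul _

lemma hardy {u u' : ℝ → ℝ} (hd : ∀ t, 0 < t → HasDerivAt u (u' t) t)
    (ht : Tendsto u (nhdsWithin 0 (Ioi 0)) (nhds 0))
    (hi : IntegrableOn (fun t => u' t ^ 2) (Ioi 0)) :
    ∫⁻ t in Ioi 0, ENNReal.ofReal (u t ^ 2 / t ^ 2) ≤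
      4 * ∫⁻ t in Ioi 0, ENNReal.ofReal (u' t ^ 2) := by
  set U := (fun t => if 0 < t then u t else 0) with hU
  have hc : Continuous U := ext_contOn hd ht
  have hdU : ∀ t, 0 < t → HasDerivAt U (u' t) t := fun t h => ext_deriv hd h
  have h0 : U 0 = 0 := by simp [hU]
  have step : ∀ k : ℕ, ∫⁻ t in Ioi 0, (Ioc (0:ℝ) (k+1)).indicator
      (fun t => ENNReal.ofReal (U t ^ 2 / (t + 1 / ((k:ℝ)+1)) ^ 2)) t ≤
      4 * ∫⁻ t in Ioi 0, ENNReal.ofReal (u' t ^ 2) := by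
    intro k
    have hk : (0:ℝ) < k + 1 := by positivity
    have hk' : (0:ℝ) < 1 / ((k:ℝ) + 1) := by positivity
    have h1 := hardy_aux hc h0 hdU hi _ _ hk' hk
    have hcont : ContinuousOn (fun t => U t ^ 2 / (t + 1 / ((k:ℝ)+1)) ^ 2) (Icc 0 ((k:ℝ)+1)) := by
      apply ContinuousOn.div (by fun_prop) (by fun_prop)
      intro t ht
      have := ht.1
      positivity
    rw [lintegral_indicator measurableSet_Ioc, Measure.restrict_restrict measurableSet_Ioc,
      inter_eq_left.2 Ioc_subset_Ioi_self]
    rw [intervalIntegral.integral_of_le hk.le, intervalIntegral.integral_of_le hk.le] at h1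
    rw [← ofReal_integral_eq_lintegral_ofReal (hcont.integrableOn_Icc.mono_set Ioc_subset_Icc_self)
      (Eventually.of_forall fun t => by positivity)]
    calc _ ≤ ENNReal.ofReal (4 * ∫ t in Ioc (0:ℝ) (k+1), u' t ^ 2) := ENNReal.ofReal_le_ofReal h1
      _ = 4 * ENNReal.ofReal (∫ t in Ioc (0:ℝ) (k+1), u' t ^ 2) := by
        rw [ENNReal.ofReal_mul (by norm_num)]; norm_num
      _ = 4 * ∫⁻ t in Ioc (0:ℝ) (k+1), ENNReal.ofReal (u' t ^ 2) := by
        rw [ofReal_integral_eq_lintegral_ofReal (hi.mono_set Ioc_subset_Ioi_self)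
          (Eventually.of_forall fun t => by positivity)]
      _ ≤ _ := by
        gcongr
        exact Ioc_subset_Ioi_self
  have fat := lintegral_liminf_le (μ := volume.restrict (Ioi (0:ℝ))) (u := atTop)
    (f := fun (k : ℕ) => (Ioc (0:ℝ) (k+1)).indicator
      (fun t => ENNReal.ofReal (U t ^ 2 / (t + 1 / ((k:ℝ)+1)) ^ 2)))
    (fun k => (by
      apply Measurable.indicator _ measurableSet_Ioc
      have := hc.measurable
      fun_prop))
  refine le_trans ?_ (fat.trans ?_)
  · apply setLIntegral_mono' measurableSet_Ioi
    intro t ht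
    have htt : Tendsto (fun (k : ℕ) => (Ioc (0:ℝ) (k+1)).indicator
      (fun t => ENNReal.ofReal (U t ^ 2 / (t + 1 / ((k:ℝ)+1)) ^ 2)) t) atTop
        (nhds (ENNReal.ofReal (u t ^ 2 / t ^ 2))) := by
      have hUt : U t = u t := by simp only [hU]; rw [if_pos (mem_Ioi.1 ht)]
      have h1 : Tendsto (fun k : ℕ => ENNReal.ofReal (U t ^ 2 / (t + 1 / ((k:ℝ)+1)) ^ 2)) atTop
        (nhds (ENNReal.ofReal (u t ^ 2 / t ^ 2))) := by
        rw [hUt]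
        apply ENNReal.tendsto_ofReal
        have : t ≠ 0 := ne_of_gt ht
        have h2 := tendsto_one_div_add_atTop_nhds_zero_nat (𝕜 := ℝ)
        have h3 := (h2.const_add t).pow 2
        rw [add_zero] at h3
        exact Tendsto.div tendsto_const_nhds h3 (pow_ne_zero 2 this)
      refine h1.congr' ?_
      obtain ⟨N, hN⟩ := exists_nat_ge t
      filter_upwards [eventually_ge_atTop N] with k hk
      rw [indicator_of_mem]
      refine ⟨ht, ?_⟩
      have : (N:ℝ) ≤ k := by exact_mod_cast hk
      linarith
    rw [htt.liminf_eq]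
  · exact liminf_le_of_le ⟨0, by simp⟩ (fun b hb => by
      obtain ⟨k, hk⟩ := hb.exists
      exact hk.trans (step k))

lemma good_sign {u u' : ℝ → ℝ} (hd : ∀ t, 0 < t → HasDerivAt u (u' t) t)
    (ht : Tendsto u (nhdsWithin 0 (Ioi 0)) (nhds 0)) (s : ℝ) (hs : 0 < s)
    (hi : IntegrableOn (fun t => u t * u' t * (1 / (1 + s * t) ^ 2)) (Ioi 0)) :
    0 ≤ ∫ t in Ioi 0, u t * u' t * (1 / (1 + s * t) ^ 2) := by
  set U := (fun t => if 0 < t then u t else 0) with hU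
  have hc : Continuous U := ext_contOn hd ht
  have hdU : ∀ t, 0 < t → HasDerivAt U (u' t) t := fun t h => ext_deriv hd h
  have h0 : U 0 = 0 := by simp [hU]
  have hlim := intervalIntegral_tendsto_integral_Ioi (0:ℝ) hi tendsto_id
  refine ge_of_tendsto hlim ?_
  filter_upwards [eventually_gt_atTop 0] with T hT
  have key := intervalIntegral.sub_le_integral_of_hasDeriv_right_of_le (a := 0) (b := T)
    (g := fun t => 1/2 * U t ^ 2 * (1 / (1 + s * t) ^ 2))
    (g' := fun t => U t * u' t * (1 / (1 + s * t) ^ 2) + 1/2 * U t ^ 2 * (-(2 * s) / (1 + s * t) ^ 3))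
    (φ := fun t => u t * u' t * (1 / (1 + s * t) ^ 2)) hT.le
    (by
      apply ContinuousOn.mul (by fun_prop)
      apply ContinuousOn.div (by fun_prop) (by fun_prop)
      intro t ht
      have := ht.1
      positivity)
    (by
      intro t ht
      have h1 := hdU t ht.1
      have h3 : 1 + s * t ≠ 0 := by have := ht.1; positivity
      have h4 : HasDerivAt (fun t => 1 + s * t) s t := by
        simpa using ((hasDerivAt_id t).const_mul s).const_add 1
      have h2 := ((h1.pow 2).const_mul (1/2)).mul ((hasDerivAt_const t (1:ℝ)).div (h4.pow 2)
        (pow_ne_zero 2 h3))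
      refine (HasDerivAt.congr_deriv h2 ?_).hasDerivWithinAt
      simp
      field_simp)
    (by
      rw [integrableOn_Icc_iff_integrableOn_Ioc]
      exact hi.mono_set Ioc_subset_Ioi_self)
    (by
      intro t ht
      have hUt : U t = u t := by simp only [hU]; rw [if_pos ht.1]
      have h3 : 0 < 1 + s * t := by have := ht.1; positivity
      rw [hUt]
      have : 0 ≤ 1/2 * u t ^ 2 * ((2 * s) / (1 + s * t) ^ 3) := by positivity
      rw [neg_div]
      linarith)
  simp only [h0] at key
  have : 0 ≤ 1/2 * U T ^ 2 * (1 / (1 + s * T) ^ 2) := by positivity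
  norm_num at key this ⊢
  linarith


/-- slope of the cone -/
def kap (a : ℝ) : ℝ := Real.sqrt ((1 + a) ^ 2 - 1)

lemma kap_pos {a : ℝ} (ha : 0 < a) : 0 < kap a := Real.sqrt_pos.2 (by nlinarith)

lemma mem_cone_iff {n : ℕ} {a : ℝ} (ha : 0 < a) (q : EE n) (X : Pt n) :
    X ∈ cone a q ↔ 0 < X.2 ∧ dist X.1 q ≤ kap a * X.2 := by
  unfold cone dist2
  simp only [mem_ofPred_eq, sub_zero]
  refine and_congr_right fun h => ?_
  rw [Real.sqrt_le_left (by positivity)]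
  have hk : kap a ^ 2 = (1 + a) ^ 2 - 1 := Real.sq_sqrt (by nlinarith)
  have hk0 := kap_pos ha
  have h1 : dist X.1 q ≤ kap a * X.2 ↔ dist X.1 q ^ 2 ≤ (kap a * X.2) ^ 2 :=
    (sq_le_sq₀ dist_nonneg (mul_pos hk0 h).le).symm
  rw [h1, mul_pow, mul_pow, hk]
  constructor <;> intro h <;> nlinarith

lemma tent_bound {n : ℕ} (hn : 2 ≤ n) (κ : ℝ) (hκ : 0 < κ) (μ : Measure (Pt n)) (K : ℝ)
    (hμ : CarlNormLE μ K) (E : Set (Pt n)) (U : Set (EE n)) (hU : volume U < ⊤)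
    (hE : ∀ X ∈ E, 0 < X.2) (hEU : ∀ X ∈ E, Metric.closedBall X.1 (κ * X.2) ⊆ U) :
    μ E ≤ ENNReal.ofReal K * (ENNReal.ofReal (((3 * κ + 3) / κ) ^ (n - 1)) * volume U) := by
  have hfr : Module.finrank ℝ (EE n) = n - 1 := by simp
  set v := volume (Metric.ball (0 : EE n) 1) with hv
  have hv0 : v ≠ 0 := (Metric.measure_ball_pos _ _ one_pos).ne'
  have hvt : v ≠ ⊤ := measure_ball_lt_top.ne
  have hball : ∀ (x : EE n) (r : ℝ), 0 ≤ r →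
      volume (Metric.closedBall x r) = ENNReal.ofReal (r ^ (n - 1)) * v := by
    intro x r hr
    rw [Measure.addHaar_closedBall _ _ hr, hfr]
  have hball' : ∀ (x : EE n) (r : ℝ), 0 < r →
      volume (Metric.ball x r) = ENNReal.ofReal (r ^ (n - 1)) * v := by
    intro x r hr
    rw [Measure.addHaar_ball_of_pos _ _ hr, hfr]
  -- bound on heights
  have hbd : ∀ X ∈ E, κ * X.2 ≤ 1 + (volume U / v).toReal := by
    intro X hX
    have hp : 0 < κ * X.2 := mul_pos hκ (hE X hX)
    have h1 : ENNReal.ofReal ((κ * X.2) ^ (n - 1)) * v ≤ volume U := by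
      rw [← hball X.1 _ hp.le]; exact measure_mono (hEU X hX)
    have h2 : ENNReal.ofReal ((κ * X.2) ^ (n - 1)) ≤ volume U / v := by
      rw [ENNReal.le_div_iff_mul_le (Or.inl hv0) (Or.inl hvt)]; exact h1
    have h3 : (κ * X.2) ^ (n - 1) ≤ (volume U / v).toReal := by
      rw [← ENNReal.ofReal_le_iff_le_toReal (ENNReal.div_lt_top hU.ne hv0).ne]; exact h2
    by_cases h4 : 1 ≤ κ * X.2
    · have : κ * X.2 ≤ (κ * X.2) ^ (n - 1) := le_self_pow₀ h4 (by omega)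
      linarith
    · have : 0 ≤ (volume U / v).toReal := ENNReal.toReal_nonneg
      linarith
  obtain ⟨u, huE, hdisj, hcov⟩ := Vitali.exists_disjoint_subfamily_covering_enlargement
    (fun X : Pt n => Metric.closedBall X.1 (κ * X.2)) E (fun X => κ * X.2) 2 (by norm_num)
    (fun X hX => (mul_pos hκ (hE X hX)).le) _ hbd
    (fun X hX => ⟨X.1, Metric.mem_closedBall_self (mul_pos hκ (hE X hX)).le⟩)
  have hcount : u.Countable := by
    apply hdisj.countable_of_nonempty_interior
    intro X hX
    refine ⟨X.1, ?_⟩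
    apply interior_mono Metric.ball_subset_closedBall
    rw [Metric.isOpen_ball.interior_eq]
    exact Metric.mem_ball_self (mul_pos hκ (hE X (huE hX)))
  have hsub : E ⊆ ⋃ b ∈ u, Metric.ball b.1 ((3 * κ + 3) * b.2) ×ˢ Ioo 0 ((3 * κ + 3) * b.2) := by
    intro X hX
    obtain ⟨b, hb, ⟨y, hy1, hy2⟩, hle⟩ := hcov X hX
    have hbp := hE b (huE hb)
    have hXp := hE X hX
    have hle' : X.2 ≤ 2 * b.2 := by
      have : κ * X.2 ≤ κ * (2 * b.2) := by linarith
      exact le_of_mul_le_mul_left this hκ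
    simp only [mem_iUnion]
    refine ⟨b, hb, ?_, hXp, ?_⟩
    · rw [Metric.mem_ball]
      have h1 : dist X.1 b.1 ≤ dist X.1 y + dist y b.1 := dist_triangle _ _ _
      have h2 := Metric.mem_closedBall.1 hy1
      have h3 := Metric.mem_closedBall.1 hy2
      rw [dist_comm] at h2
      nlinarith
    · nlinarith [mul_pos hκ hbp]
  have hL : 0 < 3 * κ + 3 := by positivity
  have := hcount.to_subtype
  calc μ E ≤ μ (⋃ b ∈ u, Metric.ball b.1 ((3 * κ + 3) * b.2) ×ˢ Ioo 0 ((3 * κ + 3) * b.2)) :=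
        measure_mono hsub
    _ ≤ ∑' b : u, μ (Metric.ball b.1.1 ((3 * κ + 3) * b.1.2) ×ˢ Ioo 0 ((3 * κ + 3) * b.1.2)) :=
        measure_biUnion_le _ hcount _
    _ ≤ ∑' b : u, ENNReal.ofReal K * (ENNReal.ofReal (((3 * κ + 3) / κ) ^ (n - 1)) *
          volume (Metric.closedBall b.1.1 (κ * b.1.2))) := by
        refine ENNReal.tsum_le_tsum fun b => ?_
        have hbp := hE b.1 (huE b.2)
        refine (hμ _ _ (mul_pos hL hbp)).trans ?_
        rw [hball _ _ (mul_pos hκ hbp).le, hball' _ _ (mul_pos hL hbp), ← mul_assoc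
          (ENNReal.ofReal (((3 * κ + 3) / κ) ^ (n - 1))), ← ENNReal.ofReal_mul (by positivity),
          ← mul_pow]
        have : (3 * κ + 3) / κ * (κ * b.1.2) = (3 * κ + 3) * b.1.2 := by field_simp
        rw [this]
    _ = ENNReal.ofReal K * (ENNReal.ofReal (((3 * κ + 3) / κ) ^ (n - 1)) *
          ∑' b : u, volume (Metric.closedBall b.1.1 (κ * b.1.2))) := by
        rw [ENNReal.tsum_mul_left, ENNReal.tsum_mul_left]
    _ ≤ _ := by
        gcongr
        rw [← measure_biUnion hcount hdisj (fun b _ => Metric.isClosed_closedBall.measurableSet)]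
        apply measure_mono
        exact iUnion₂_subset fun b hb => hEU b (huE hb)

lemma isOpen_NT {n : ℕ} {a : ℝ} (ha : 0 < a) {F : Pt n → ℝ} (hF : ContinuousOn F (UHS n)) (c : ℝ≥0∞) :
    IsOpen {q | c < NT a F q} := by
  rw [isOpen_iff_mem_nhds]
  intro q hq
  simp only [mem_ofPred_eq, NT, lt_iSup_iff] at hq
  obtain ⟨X, hX, hc⟩ := hq
  rw [mem_cone_iff ha] at hX
  have hopen : IsOpen (UHS n) := isOpen_lt continuous_const continuous_snd
  have hFX : ContinuousAt F X := hF.continuousAt (hopen.mem_nhds hX.1)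
  have h1 : ContinuousAt (fun s : ℝ => ENNReal.ofReal |F (X.1, s)|) X.2 := by
    have h2 : ContinuousAt (fun s : ℝ => F (X.1, s)) X.2 :=
      ContinuousAt.comp (f := fun s : ℝ => ((X.1, s) : Pt n)) hFX (by fun_prop)
    exact ENNReal.continuous_ofReal.continuousAt.comp h2.abs
  have h3 : ∀ᶠ s in nhds X.2, c < ENNReal.ofReal |F (X.1, s)| := h1.eventually (lt_mem_nhds hc)
  obtain ⟨s, hs1, hs2⟩ := ((h3.filter_mono nhdsWithin_le_nhds).and
    (self_mem_nhdsWithin : Ioi X.2 ∈ nhdsWithin X.2 (Ioi X.2))).exists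
  have hk := kap_pos ha
  have hlt : dist X.1 q < kap a * s := lt_of_le_of_lt hX.2 (mul_lt_mul_of_pos_left hs2 hk)
  have h5 : ∀ᶠ p in nhds q, dist X.1 p < kap a * s :=
    (continuous_const.dist continuous_id).continuousAt.eventually (gt_mem_nhds hlt)
  filter_upwards [h5] with p hp
  refine lt_of_lt_of_le hs1 ?_
  have hmem : ((X.1, s) : Pt n) ∈ cone a p := by
    rw [mem_cone_iff ha]
    exact ⟨hX.1.trans hs2, hp.le⟩
  exact le_iSup₂ (f := fun X (_ : X ∈ cone a p) => ENNReal.ofReal |F X|) (X.1, s) hmem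

lemma measurable_NT {n : ℕ} {a : ℝ} (ha : 0 < a) {F : Pt n → ℝ} (hF : ContinuousOn F (UHS n)) :
    Measurable (NT a F) :=
  measurable_of_Ioi fun c => (isOpen_NT ha hF c).measurableSet

lemma measurableSet_UHS (n : ℕ) : MeasurableSet (UHS n) :=
  (isOpen_lt continuous_const continuous_snd).measurableSet

lemma carl_zero {n : ℕ} (μ : Measure (Pt n)) (K : ℝ) (hμ : CarlNormLE μ K) (hK : K ≤ 0) :
    μ (UHS n) = 0 := by
  have : UHS n ⊆ ⋃ k : ℕ, Metric.ball (0 : EE n) (k + 1) ×ˢ Ioo 0 ((k : ℝ) + 1) := by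
    intro X hX
    obtain ⟨k, hk⟩ := exists_nat_ge (max ‖X.1‖ X.2)
    simp only [mem_iUnion]
    refine ⟨k, ?_, hX, ?_⟩
    · rw [mem_ball_zero_iff]; linarith [le_max_left ‖X.1‖ X.2]
    · linarith [le_max_right ‖X.1‖ X.2]
  refine measure_mono_null this (measure_iUnion_null fun k => ?_)
  have := hμ 0 ((k : ℝ) + 1) (by positivity)
  rw [ENNReal.ofReal_eq_zero.2 hK, zero_mul] at this
  exact le_antisymm this (zero_le)

lemma carleson_embedding {n : ℕ} (hn : 2 ≤ n) {a : ℝ} (ha : 0 < a) (μ : Measure (Pt n)) (K : ℝ)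
    (hμ : CarlNormLE μ K) {F : Pt n → ℝ} (hF : ContinuousOn F (UHS n)) :
    ∫⁻ X in UHS n, ENNReal.ofReal (F X ^ 2) ∂μ ≤
      ENNReal.ofReal K * (ENNReal.ofReal (((3 * kap a + 3) / kap a) ^ (n - 1)) *
        ∫⁻ q, NT a F q ^ 2) := by
  have hkap := kap_pos ha
  by_cases hK : K ≤ 0
  · rw [setLIntegral_measure_zero _ _ (carl_zero μ K hμ hK)]; exact zero_le
  push Not at hK
  set cc := ENNReal.ofReal (((3 * kap a + 3) / kap a) ^ (n - 1)) with hcc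
  have hcc0 : cc ≠ 0 := by
    rw [hcc]; simp only [ne_eq, ENNReal.ofReal_eq_zero, not_le]; positivity
  by_cases hfin : ∫⁻ q, NT a F q ^ 2 = ⊤
  · rw [hfin, ENNReal.mul_top hcc0, ENNReal.mul_top]
    · exact le_top
    · simpa using hK
  have hmeas := measurable_NT ha hF
  have hae : ∀ᵐ q, NT a F q ^ 2 < ⊤ := ae_lt_top (hmeas.pow_const 2) hfin
  have hFm : AEMeasurable (fun X => F X ^ 2) (μ.restrict (UHS n)) :=
    (hF.pow 2).aemeasurable (measurableSet_UHS n)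
  rw [lintegral_eq_lintegral_meas_lt _ (Eventually.of_forall fun X => sq_nonneg _) hFm]
  have hR : ∫⁻ q, NT a F q ^ 2 = ∫⁻ q, ENNReal.ofReal ((NT a F q ^ 2).toReal) := by
    apply lintegral_congr_ae
    filter_upwards [hae] with q hq
    rw [ENNReal.ofReal_toReal hq.ne]
  have hR2 : ∫⁻ q, NT a F q ^ 2 = ∫⁻ s in Ioi (0:ℝ), volume {q | ENNReal.ofReal s < NT a F q ^ 2} := by
    rw [hR, lintegral_eq_lintegral_meas_lt _ (Eventually.of_forall fun X => ENNReal.toReal_nonneg)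
      (hmeas.pow_const 2).ennreal_toReal.aemeasurable]
    apply setLIntegral_congr_fun measurableSet_Ioi
    intro s hs
    apply measure_congr
    filter_upwards [hae] with q hq
    apply propext
    show s < (NT a F q ^ 2).toReal ↔ ENNReal.ofReal s < NT a F q ^ 2
    rw [ENNReal.ofReal_lt_iff_lt_toReal (le_of_lt hs) hq.ne]
  rw [hR2, ← lintegral_const_mul', ← lintegral_const_mul']
  · apply setLIntegral_mono' measurableSet_Ioi
    intro s hs
    have hs : 0 < s := hs
    rw [Measure.restrict_apply' (measurableSet_UHS n)]
    apply tent_bound hn (kap a) hkap μ K hμ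
    · have h1 : ENNReal.ofReal s * volume {q | ENNReal.ofReal s ≤ NT a F q ^ 2} ≤
        ∫⁻ q, NT a F q ^ 2 := mul_meas_ge_le_lintegral (hmeas.pow_const 2) _
      have h2 : volume {q | ENNReal.ofReal s ≤ NT a F q ^ 2} < ⊤ := by
        by_contra h
        rw [not_lt, top_le_iff] at h
        rw [h, ENNReal.mul_top (by simpa using hs)] at h1
        exact hfin (top_le_iff.1 h1)
      exact lt_of_le_of_lt (measure_mono (ofPred_subset_ofPred.2 fun q hq => le_of_lt hq)) h2
    · exact fun X hX => hX.2
    · intro X hX q hq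
      have hmem : X ∈ cone a q := by
        rw [mem_cone_iff ha]
        exact ⟨hX.2, by rw [dist_comm]; exact hq⟩
      have hle : ENNReal.ofReal |F X| ≤ NT a F q :=
        le_iSup₂ (f := fun X (_ : X ∈ cone a q) => ENNReal.ofReal |F X|) X hmem
      have h1 : s < F X ^ 2 := hX.1
      calc ENNReal.ofReal s < ENNReal.ofReal (F X ^ 2) := by
            rw [ENNReal.ofReal_lt_ofReal_iff (by linarith)]; exact h1
        _ = ENNReal.ofReal |F X| ^ 2 := by rw [← ENNReal.ofReal_pow (abs_nonneg _), sq_abs]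
        _ ≤ _ := by gcongr
  · exact ENNReal.ofReal_ne_top
  · exact ENNReal.ofReal_ne_top


lemma bLp_sq {d : ℕ} (g : EuclideanSpace ℝ (Fin d) → ℝ≥0∞) :
    bLp 2 g ^ (2 : ℕ) = ∫⁻ q, g q ^ (2 : ℕ) := by
  unfold bLp
  rw [← ENNReal.rpow_natCast, ← ENNReal.rpow_mul]
  norm_num

lemma SF_sq {n : ℕ} (a : ℝ) (G : Pt n → ℝ) (q : EE n) :
    SF a G q ^ (2 : ℕ) =
      ∫⁻ X in cone a q, ENNReal.ofReal (G X) * ENNReal.ofReal (X.2 ^ ((2 : ℝ) - n)) := by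
  unfold SF SFon
  rw [← ENNReal.rpow_natCast, ← ENNReal.rpow_mul]
  norm_num

lemma SF_norm {n : ℕ} (hn : 2 ≤ n) {a : ℝ} (ha : 0 < a) (G : Pt n → ℝ) (hG : Measurable G) :
    bLp 2 (SF a G) ^ (2 : ℕ) =
      ENNReal.ofReal (kap a ^ (n - 1)) * volume (Metric.ball (0 : EE n) 1) *
        ∫⁻ X in UHS n, ENNReal.ofReal (G X) * ENNReal.ofReal X.2 := by
  have hfr : Module.finrank ℝ (EE n) = n - 1 := by simp
  have hk := kap_pos ha
  rw [bLp_sq]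
  simp_rw [SF_sq]
  set S : Set (EE n × Pt n) := {p | 0 < p.2.2 ∧ dist p.2.1 p.1 ≤ kap a * p.2.2} with hS
  have hSm : MeasurableSet S := by
    have h1 : IsOpen {p : EE n × Pt n | 0 < p.2.2} := isOpen_lt (by fun_prop) (by fun_prop)
    have h2 : IsClosed {p : EE n × Pt n | dist p.2.1 p.1 ≤ kap a * p.2.2} :=
      isClosed_le (by fun_prop) (by fun_prop)
    exact h1.measurableSet.inter h2.measurableSet
  set h : Pt n → ℝ≥0∞ := fun X => ENNReal.ofReal (G X) * ENNReal.ofReal (X.2 ^ ((2 : ℝ) - n)) with hh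
  have hhm : Measurable h := by
    exact hG.ennreal_ofReal.mul (measurable_snd.pow_const _).ennreal_ofReal
  have hcone : ∀ q : EE n, MeasurableSet (cone a q) := by
    intro q
    have : cone a q = (fun X => (q, X)) ⁻¹' S := by
      ext X; rw [mem_cone_iff ha]; rfl
    rw [this]
    exact (measurable_prodMk_left) hSm
  have e1 : ∀ q : EE n, ∫⁻ X in cone a q, h X = ∫⁻ X, S.indicator (fun p => h p.2) (q, X) := by
    intro q
    rw [← lintegral_indicator (hcone q)]
    congr 1; ext X
    by_cases hX : X ∈ cone a q
    · rw [indicator_of_mem hX, indicator_of_mem (by rw [mem_cone_iff ha] at hX; exact hX)]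
    · rw [indicator_of_notMem hX, indicator_of_notMem (by rw [mem_cone_iff ha] at hX; exact hX)]
  simp_rw [e1]
  rw [lintegral_lintegral_swap (f := fun q X => S.indicator (fun p => h p.2) (q, X))]
  swap
  · exact ((hhm.comp measurable_snd).indicator hSm).aemeasurable
  rw [← lintegral_indicator (measurableSet_UHS n), ← lintegral_const_mul]
  swap
  · exact Measurable.indicator (hG.ennreal_ofReal.mul measurable_snd.ennreal_ofReal)
      (measurableSet_UHS n)
  congr 1; ext X
  by_cases hX : X ∈ UHS n
  · have hXp : 0 < X.2 := hX
    have e2 : ∀ q : EE n, S.indicator (fun p => h p.2) (q, X) =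
        (Metric.closedBall X.1 (kap a * X.2)).indicator (fun _ => h X) q := by
      intro q
      by_cases hq : q ∈ Metric.closedBall X.1 (kap a * X.2)
      · rw [indicator_of_mem hq, indicator_of_mem]
        exact ⟨hXp, by rw [dist_comm]; exact hq⟩
      · rw [indicator_of_notMem hq, indicator_of_notMem]
        rintro ⟨_, h2⟩
        exact hq (by rw [Metric.mem_closedBall, dist_comm]; exact h2)
    simp_rw [e2]
    rw [lintegral_indicator_const Metric.isClosed_closedBall.measurableSet, indicator_of_mem hX,
      Measure.addHaar_closedBall _ _ (by positivity), hfr]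
    simp only [hh]
    have e3 : X.2 ^ ((2 : ℝ) - n) * (kap a * X.2) ^ (n - 1) = kap a ^ (n - 1) * X.2 := by
      rw [mul_pow, ← Real.rpow_natCast X.2 (n - 1), mul_left_comm, ← Real.rpow_add hXp,
        Nat.cast_sub (by omega)]
      congr 1
      have : (2 : ℝ) - n + (n - (1 : ℕ)) = 1 := by push_cast; ring
      rw [this, Real.rpow_one]
    calc _ = ENNReal.ofReal (G X) * (ENNReal.ofReal (X.2 ^ ((2 : ℝ) - n)) *
          ENNReal.ofReal ((kap a * X.2) ^ (n - 1))) * volume (Metric.ball (0 : EE n) 1) := by ring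
      _ = _ := by
        rw [← ENNReal.ofReal_mul (by positivity), e3, ENNReal.ofReal_mul (by positivity)]; ring
  · have hXp : ¬ 0 < X.2 := hX
    rw [indicator_of_notMem hX, mul_zero]
    have e2 : ∀ q : EE n, S.indicator (fun p => h p.2) (q, X) = 0 := by
      intro q
      exact indicator_of_notMem (fun h => hXp h.1) _
    simp_rw [e2]; simp


section gen
variable {E : Type*} [NormedAddCommGroup E] [NormedSpace ℝ E] [FiniteDimensional ℝ E]
  [MeasurableSpace E] [BorelSpace E] (μ : Measure E) [μ.IsAddHaarMeasure]

lemma cont_corr {h k : E → ℝ} (hh : MemLp h 2 μ) (hk : MemLp k 2 μ) :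
    Continuous (fun y => ∫ X, h X * k (X - y) ∂μ) := by
  have hmp : ∀ y : E, MeasurePreserving (fun X => X - y) μ μ := fun y => measurePreserving_sub_right μ y
  let g : E → C(E, E) := fun y => ⟨fun X => X - y, by fun_prop⟩
  have hg : Continuous g := by
    have : Continuous (fun p : E × E => p.2 - p.1) := by fun_prop
    exact (ContinuousMap.curry ⟨_, this⟩).continuous
  have h1 : Continuous (fun y => Lp.compMeasurePreserving (g y) (hmp y) (hk.toLp k)) :=
    Continuous.compMeasurePreservingLp continuous_const hg hmp (by norm_num)
  have h2 : Continuous (fun y => inner ℝ (hh.toLp h)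
    (Lp.compMeasurePreserving (g y) (hmp y) (hk.toLp k))) := continuous_const.inner h1
  refine h2.congr fun y => ?_
  rw [L2.inner_def]
  apply integral_congr_ae
  have h3 := Lp.coeFn_compMeasurePreserving (hk.toLp k) (hmp y)
  have h4 := (hmp y).quasiMeasurePreserving.ae_eq_comp hk.coeFn_toLp
  filter_upwards [hh.coeFn_toLp, h3, h4] with X e1 e3 e4
  have e5 : (Lp.compMeasurePreserving (g y) (hmp y) (hk.toLp k)) X = k (X - y) := by
    exact e3.trans e4
  rw [e5, e1]
  simp [mul_comm]

lemma fderiv_conv {ρ w : E → ℝ} (hρ : ContDiff ℝ (⊤ : ℕ∞) ρ) (hρc : HasCompactSupport ρ)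
    (hw : Differentiable ℝ w) (d : E)
    (hdi : Integrable (fun X => fderiv ℝ w X d) μ) (X : E) :
    fderiv ℝ (MeasureTheory.convolution ρ w (ContinuousLinearMap.lsmul ℝ ℝ) μ) X d =
      ∫ y, ρ y * fderiv ℝ w (X - y) d ∂μ := by
  have hwl : LocallyIntegrable w μ := hw.continuous.locallyIntegrable
  rw [(hρc.hasFDerivAt_convolution_left (ContinuousLinearMap.lsmul ℝ ℝ)
    (hρ.of_le (by norm_cast)) hwl X).fderiv]
  have hce : ConvolutionExistsAt (fderiv ℝ ρ) w X
      ((ContinuousLinearMap.lsmul ℝ ℝ).precompL E) μ :=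
    (hρc.fderiv ℝ).convolutionExists_left _ (hρ.continuous_fderiv (by simp)) hwl X
  unfold MeasureTheory.convolution
  rw [ContinuousLinearMap.integral_apply hce]
  have hfd : ∀ y, fderiv ℝ (fun y => w (X - y)) y d = - fderiv ℝ w (X - y) d := by
    intro y
    have h1 : HasFDerivAt (fun y => X - y) (-(ContinuousLinearMap.id ℝ E)) y :=
      (hasFDerivAt_id y).const_sub X
    have h2 := (hw (X - y)).hasFDerivAt.comp y h1
    have : HasFDerivAt (fun y => w (X - y)) _ y := h2
    rw [this.fderiv]; simp
  have hcd : Continuous (fun y => fderiv ℝ ρ y d) :=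
    (hρ.continuous_fderiv (by simp)).clm_apply continuous_const
  have hsupp : HasCompactSupport (fun y => fderiv ℝ ρ y d) := by
    exact hρc.fderiv_apply ℝ d
  have hcw : Continuous (fun y => w (X - y)) := hw.continuous.comp (by fun_prop)
  have ibp := integral_mul_fderiv_eq_neg_fderiv_mul_of_integrable (μ := μ) (f := ρ)
    (g := fun y => w (X - y)) (v := d)
    ((hcd.mul hcw).integrable_of_hasCompactSupport (hsupp.mul_right))
    (by
      simp_rw [hfd]
      have h1 : Integrable (fun y => fderiv ℝ w (X - y) d) μ := hdi.comp_sub_left X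
      obtain ⟨C, hC⟩ := hρ.continuous.bounded_above_of_compact_support hρc
      exact h1.neg.bdd_mul hρ.continuous.aestronglyMeasurable (Eventually.of_forall hC))
    ((hρ.continuous.mul hcw).integrable_of_hasCompactSupport (hρc.mul_right))
    (fun y _ => (hρ.differentiable (by simp)) y)
    (fun y _ => by
      have : Differentiable ℝ (fun y => w (X - y)) := hw.comp (by fun_prop)
      exact this y)
  simp_rw [hfd] at ibp
  simp only [mul_neg, integral_neg, neg_inj] at ibp
  rw [ibp]
  rfl

lemma swap_corr {ρ h k : E → ℝ} (hρ : Continuous ρ) (hρc : HasCompactSupport ρ)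
    (hh : MemLp h 2 μ) (hk : MemLp k 2 μ) :
    Integrable (fun X => h X * ∫ y, ρ y * k (X - y) ∂μ) μ ∧
    ∫ X, h X * ∫ y, ρ y * k (X - y) ∂μ ∂μ = ∫ y, ρ y * ∫ X, h X * k (X - y) ∂μ ∂μ := by
  have hρi : Integrable ρ μ := hρ.integrable_of_hasCompactSupport hρc
  have hh2 := hh.integrable_sq
  have hk2 := hk.integrable_sq
  have hkm : AEStronglyMeasurable (fun p : E × E => k (p.1 - p.2)) (μ.prod μ) :=
    hk.1.comp_quasiMeasurePreserving (quasiMeasurePreserving_sub μ μ)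
  have h1 : Integrable (fun p : E × E => h p.1 ^ 2 * ‖ρ p.2‖) (μ.prod μ) := hh2.mul_prod hρi.norm
  have h2 : Integrable (fun p : E × E => ‖ρ p.2‖ * k (p.1 - p.2) ^ 2) (μ.prod μ) :=
    hρi.norm.convolution_integrand (ContinuousLinearMap.mul ℝ ℝ) hk2
  have hIntg : Integrable (Function.uncurry fun X y => h X * (ρ y * k (X - y))) (μ.prod μ) := by
    refine (h1.add h2).mono' ?_ ?_
    · exact hh.1.comp_fst.mul ((hρ.comp continuous_snd).aestronglyMeasurable.mul hkm)
    · refine Eventually.of_forall fun p => ?_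
      simp only [Function.uncurry, norm_mul, Pi.add_apply]
      have := abs_nonneg (ρ p.2)
      simp only [Real.norm_eq_abs]
      have h3 : |h p.1| * |k (p.1 - p.2)| ≤ h p.1 ^ 2 + k (p.1 - p.2) ^ 2 := by
        rw [← sq_abs (h p.1), ← sq_abs (k _)]
        nlinarith [sq_nonneg (|h p.1| - |k (p.1 - p.2)|), sq_nonneg (|h p.1| + |k (p.1 - p.2)|)]
      calc |h p.1| * (|ρ p.2| * |k (p.1 - p.2)|) = |ρ p.2| * (|h p.1| * |k (p.1 - p.2)|) := by ring
        _ ≤ |ρ p.2| * (h p.1 ^ 2 + k (p.1 - p.2) ^ 2) := by gcongr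
        _ = _ := by ring
  constructor
  · have := hIntg.integral_prod_left
    simp only [Function.uncurry, integral_const_mul] at this
    exact this
  · have := integral_integral_swap hIntg
    simp only [integral_const_mul] at this
    rw [this]
    congr 1; ext y
    rw [← integral_const_mul]
    congr 1; ext X; ring

lemma test_extend {ι : Type*} [Fintype ι] (d : ι → E) (H : ι → E → ℝ) (hH : ∀ i, MemLp (H i) 2 μ)
    {w : E → ℝ} (hw : Differentiable ℝ w) (hwc : HasCompactSupport w)
    (hdw : ∀ i, MemLp (fun X => fderiv ℝ w X (d i)) 2 μ) (δ : ℝ) (hδ : 0 < δ)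
    (hyp : ∀ ρ : E → ℝ, ContDiff ℝ (⊤ : ℕ∞) ρ → HasCompactSupport ρ →
      Function.support ρ ⊆ Metric.ball 0 δ →
      ∫ X, ∑ i, H i X * fderiv ℝ (MeasureTheory.convolution ρ w (ContinuousLinearMap.lsmul ℝ ℝ) μ) X (d i) ∂μ = 0) :
    ∫ X, ∑ i, H i X * fderiv ℝ w X (d i) ∂μ = 0 := by
  have hdi : ∀ i, Integrable (fun X => fderiv ℝ w X (d i)) μ := by
    intro i
    have hs : HasCompactSupport (fun X => fderiv ℝ w X (d i)) := hwc.fderiv_apply ℝ (d i)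
    have h1 : MemLp (fun X => fderiv ℝ w X (d i)) 1 (μ.restrict (tsupport (fun X => fderiv ℝ w X (d i)))) := by
      have : IsFiniteMeasure (μ.restrict (tsupport (fun X => fderiv ℝ w X (d i)))) :=
        ⟨by rw [Measure.restrict_apply_univ]; exact hs.isCompact.measure_lt_top⟩
      exact ((hdw i).restrict _).mono_exponent (by norm_num)
    rw [memLp_one_iff_integrable] at h1
    exact (integrableOn_iff_integrable_of_support_subset (subset_tsupport _)).1 h1
  set G : E → ℝ := fun y => ∑ i, ∫ X, H i X * fderiv ℝ w (X - (-y)) (d i) ∂μ with hG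
  have hGc : Continuous G := by
    apply continuous_finsetSum
    intro i _
    exact (cont_corr μ (hH i) (hdw i)).comp continuous_neg
  let φ : ℕ → ContDiffBump (0 : E) := fun k => ⟨δ / (2 * (k + 2)), δ / (k + 2), by positivity, by
    gcongr; linarith [(Nat.cast_nonneg k : (0:ℝ) ≤ k)]⟩
  have hφ : Tendsto (fun k => (φ k).rOut) atTop (nhds 0) := by
    show Tendsto (fun k : ℕ => δ / ((k : ℝ) + 2)) atTop (nhds 0)
    apply Tendsto.div_atTop tendsto_const_nhds
    exact tendsto_atTop_add_const_right _ _ tendsto_natCast_atTop_atTop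
  have hlim := ContDiffBump.convolution_tendsto_right_of_continuous (μ := μ) hφ hGc 0
  have hz : ∀ k, MeasureTheory.convolution ((φ k).normed μ) G (ContinuousLinearMap.lsmul ℝ ℝ) μ 0 = 0 := by
    intro k
    have hcs : HasCompactSupport ((φ k).normed μ) := (φ k).hasCompactSupport_normed
    have hcd : ContDiff ℝ (⊤ : ℕ∞) ((φ k).normed μ) := (φ k).contDiff_normed
    have h1 := hyp ((φ k).normed μ) hcd hcs (by
      rw [(φ k).support_normed_eq]
      apply Metric.ball_subset_ball
      show δ / ((k : ℝ) + 2) ≤ δ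
      apply div_le_self hδ.le
      linarith [(Nat.cast_nonneg k : (0:ℝ) ≤ k)])
    simp_rw [fun (i : ι) (X : E) => fderiv_conv μ hcd hcs hw (d i) (hdi i) X] at h1
    rw [integral_finsetSum _ (fun i _ => (swap_corr μ hcd.continuous hcs (hH i) (hdw i)).1)] at h1
    simp_rw [fun i => (swap_corr μ hcd.continuous hcs (hH i) (hdw i)).2] at h1
    unfold MeasureTheory.convolution
    rw [← h1, ← integral_finsetSum]
    · congr 1; ext y
      simp only [hG, ContinuousLinearMap.lsmul_apply, smul_eq_mul, zero_sub, neg_neg, Finset.mul_sum]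
    · intro i _
      exact (hcd.continuous.mul (cont_corr μ (hH i) (hdw i))).integrable_of_hasCompactSupport
        hcs.mul_right
  have h0 : G 0 = 0 := by
    refine tendsto_nhds_unique hlim ?_
    simp_rw [hz]; exact tendsto_const_nhds
  rw [integral_finsetSum]
  · simpa [hG] using h0
  · intro i _
    exact (hH i).integrable_mul (hdw i)

end gen

lemma isOpen_UHS (n : ℕ) : IsOpen (UHS n) := isOpen_lt continuous_const continuous_snd

lemma haar_Pt (n : ℕ) : (volume : Measure (Pt n)).IsAddHaarMeasure :=
  inferInstanceAs (((volume : Measure (EE n)).prod (volume : Measure ℝ)).IsAddHaarMeasure)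

lemma test_UHS {n : ℕ} {ι : Type*} [Fintype ι] (d : ι → Pt n) (H : ι → Pt n → ℝ)
    (hH : ∀ i, ∀ K, IsCompact K → K ⊆ UHS n → MemLp (H i) 2 (volume.restrict K))
    (hyp : ∀ φ, TestFun (UHS n) φ → ∫ X in UHS n, ∑ i, H i X * fderiv ℝ φ X (d i) = 0)
    {w : Pt n → ℝ} (hw : Differentiable ℝ w) (hwc : HasCompactSupport w)
    (hws : tsupport w ⊆ UHS n) (hdw : ∀ i, MemLp (fun X => fderiv ℝ w X (d i)) 2 volume) :
    ∫ X in UHS n, ∑ i, H i X * fderiv ℝ w X (d i) = 0 := by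
  obtain ⟨δ, hδ, hδs⟩ := hwc.isCompact.exists_cthickening_subset_open (isOpen_UHS n) hws
  set K := Metric.cthickening δ (tsupport w) with hK
  have hKc : IsCompact K := hwc.isCompact.cthickening
  have key : ∀ φ : Pt n → ℝ, tsupport φ ⊆ K →
      ∫ X in UHS n, ∑ i, H i X * fderiv ℝ φ X (d i) =
      ∫ X, ∑ i, K.indicator (H i) X * fderiv ℝ φ X (d i) := by
    intro φ hφ
    have h0 : ∀ X, X ∉ K → fderiv ℝ φ X = 0 := by
      intro X hX
      by_contra h
      exact hX (hφ (support_fderiv_subset ℝ h))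
    rw [setIntegral_eq_integral_of_forall_compl_eq_zero]
    · congr 1; ext X
      by_cases hX : X ∈ K
      · simp [hX]
      · simp [h0 X hX]
    · intro X hX
      simp [h0 X (fun h => hX (hδs h))]
  have hwK : tsupport w ⊆ K := Metric.self_subset_cthickening _
  rw [key w hwK]
  haveI := haar_Pt n
  refine test_extend volume d (fun i => K.indicator (H i)) ?_ hw hwc hdw δ hδ ?_
  · intro i
    exact (memLp_indicator_iff_restrict hKc.measurableSet).2 (hH i K hKc hδs)
  · intro ρ hρ hρc hρs
    have hs : tsupport (MeasureTheory.convolution ρ w (ContinuousLinearMap.lsmul ℝ ℝ) volume) ⊆ K := by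
      refine closure_minimal ?_ hKc.isClosed
      refine (support_convolution_subset _).trans ?_
      rintro _ ⟨x, hx, y, hy, rfl⟩
      have := hρs hx
      apply Metric.thickening_subset_cthickening
      rw [Metric.mem_thickening_iff]
      refine ⟨y, subset_tsupport _ hy, ?_⟩
      simpa [dist_eq_norm] using this
    rw [← key _ hs]
    apply hyp
    refine ⟨?_, ?_, hs.trans hδs⟩
    · exact hρc.contDiff_convolution_left _ hρ hw.continuous.locallyIntegrable
    · exact hKc.of_isClosed_subset (isClosed_tsupport _) hs

lemma sT_deriv_zero {y : ℝ} (h : y < 0 ∨ 1 < y) : deriv Real.smoothTransition y = 0 := by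
  rcases h with h | h
  · have : Real.smoothTransition =ᶠ[nhds y] fun _ => 0 := by
      filter_upwards [Iio_mem_nhds h] with z hz
      exact Real.smoothTransition.zero_of_nonpos (le_of_lt hz)
    rw [this.deriv_eq]; simp
  · have : Real.smoothTransition =ᶠ[nhds y] fun _ => 1 := by
      filter_upwards [Ioi_mem_nhds h] with z hz
      exact Real.smoothTransition.one_of_one_le (le_of_lt hz)
    rw [this.deriv_eq]; simp

lemma sT_bound : ∃ A : ℝ, 0 ≤ A ∧ ∀ y, |deriv Real.smoothTransition y| ≤ A := by
  have hc : Continuous (deriv Real.smoothTransition) :=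
    (Real.smoothTransition.contDiff (n := 1)).continuous_deriv (by norm_num)
  have hs : HasCompactSupport (deriv Real.smoothTransition) := by
    apply HasCompactSupport.intro (isCompact_Icc (a := (0:ℝ)) (b := 1))
    intro x hx
    apply sT_deriv_zero
    by_contra h
    push Not at h
    exact hx ⟨h.1, h.2⟩
  obtain ⟨C, hC⟩ := hc.bounded_above_of_compact_support hs
  exact ⟨C, (norm_nonneg _).trans (hC 0), hC⟩

/-- Smooth cutoff functions exhausting the half-space. -/
def cutf (n : ℕ) (K : ℝ) (X : Pt n) : ℝ :=
  Real.smoothTransition (K * X.2 - 1) * Real.smoothTransition (2 - (‖X.1‖ ^ 2 + X.2 ^ 2) / K ^ 2)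

lemma cutf_hasFDerivAt (n : ℕ) (K : ℝ) (X : Pt n) :
    ∃ L : Pt n →L[ℝ] ℝ, HasFDerivAt (cutf n K) L X ∧
      (∀ i, L (EuclideanSpace.single i 1, 0) = Real.smoothTransition (K * X.2 - 1) *
        (deriv Real.smoothTransition (2 - (‖X.1‖ ^ 2 + X.2 ^ 2) / K ^ 2) * (-(2 * X.1 i) / K ^ 2))) ∧
      L (0, 1) = Real.smoothTransition (K * X.2 - 1) *
        (deriv Real.smoothTransition (2 - (‖X.1‖ ^ 2 + X.2 ^ 2) / K ^ 2) * (-(2 * X.2) / K ^ 2)) +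
        Real.smoothTransition (2 - (‖X.1‖ ^ 2 + X.2 ^ 2) / K ^ 2) *
        (deriv Real.smoothTransition (K * X.2 - 1) * K) := by
  have hd : ∀ y, HasDerivAt Real.smoothTransition (deriv Real.smoothTransition y) y := fun y =>
    (((Real.smoothTransition.contDiff (n := 1)).differentiable (by norm_num)) y).hasDerivAt
  have h1 : HasFDerivAt (fun X : Pt n => K * X.2 - 1) (K • ContinuousLinearMap.snd ℝ (EE n) ℝ) X :=
    ((hasFDerivAt_snd (𝕜 := ℝ) (E := EE n) (F := ℝ) (p := X)).const_mul K).sub_const 1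
  have hf := (hasFDerivAt_fst (𝕜 := ℝ) (E := EE n) (F := ℝ) (p := X)).norm_sq
  have hs := (hasFDerivAt_snd (𝕜 := ℝ) (E := EE n) (F := ℝ) (p := X)).pow 2
  have h2 := ((hf.add hs).mul_const (K ^ 2)⁻¹).const_sub 2
  have h1' := (hd (K * X.2 - 1)).comp_hasFDerivAt X h1
  have h2' := (hd _).comp_hasFDerivAt X h2
  refine ⟨_, (h1'.mul h2'), ?_, ?_⟩
  · intro i
    simp [EuclideanSpace.inner_single_right, div_eq_mul_inv]
    ring_nf; tauto
  · simp [div_eq_mul_inv]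
    ring_nf; simp

lemma cutf_pdx {n : ℕ} (K : ℝ) (X : Pt n) (i : Fin (n-1)) : pdx i (cutf n K) X =
   Real.smoothTransition (K * X.2 - 1) *
        (deriv Real.smoothTransition (2 - (‖X.1‖ ^ 2 + X.2 ^ 2) / K ^ 2) * (-(2 * X.1 i) / K ^ 2)) := by
  obtain ⟨L, hL, h1, h2⟩ := cutf_hasFDerivAt n K X
  rw [pdx, hL.fderiv, h1]

lemma cutf_pdt {n : ℕ} (K : ℝ) (X : Pt n) : pdt (cutf n K) X =
   Real.smoothTransition (K * X.2 - 1) *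
        (deriv Real.smoothTransition (2 - (‖X.1‖ ^ 2 + X.2 ^ 2) / K ^ 2) * (-(2 * X.2) / K ^ 2)) +
        Real.smoothTransition (2 - (‖X.1‖ ^ 2 + X.2 ^ 2) / K ^ 2) *
        (deriv Real.smoothTransition (K * X.2 - 1) * K) := by
  obtain ⟨L, hL, h1, h2⟩ := cutf_hasFDerivAt n K X
  rw [pdt, hL.fderiv, h2]

lemma cutf_test (n : ℕ) (K : ℝ) (hK : 1 ≤ K) : TestFun (UHS n) (cutf n K) := by
  have hK0 : 0 < K := by linarith
  set S : Set (Pt n) := Metric.closedBall 0 (2 * K) ∩ {X | 1 ≤ K * X.2} with hS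
  have hSc : IsCompact S := (isCompact_closedBall _ _).inter_right
    (isClosed_le continuous_const (by fun_prop))
  have hsub : tsupport (cutf n K) ⊆ S := by
    refine closure_minimal ?_ hSc.isClosed
    intro X hX
    have h1 : 0 < K * X.2 - 1 := by
      by_contra h
      apply hX; simp [cutf, Real.smoothTransition.zero_of_nonpos (not_lt.1 h)]
    have h2 : 0 < 2 - (‖X.1‖ ^ 2 + X.2 ^ 2) / K ^ 2 := by
      by_contra h
      apply hX; simp [cutf, Real.smoothTransition.zero_of_nonpos (not_lt.1 h)]
    have h3 : ‖X.1‖ ^ 2 + X.2 ^ 2 < 2 * K ^ 2 := by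
      rw [sub_pos, div_lt_iff₀ (by positivity)] at h2; exact h2
    refine ⟨?_, by show 1 ≤ K * X.2; linarith⟩
    rw [mem_closedBall_zero_iff, Prod.norm_def, max_le_iff]
    constructor
    · exact abs_le_of_sq_le_sq' (by nlinarith [sq_nonneg X.2]) (by linarith) |>.2
    · exact abs_le_of_sq_le_sq (by nlinarith [sq_nonneg ‖X.1‖]) (by linarith)
  refine ⟨?_, hSc.of_isClosed_subset (isClosed_tsupport _) hsub, hsub.trans ?_⟩
  · unfold cutf
    apply ContDiff.mul
    · exact Real.smoothTransition.contDiff.comp (by fun_prop)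
    · refine Real.smoothTransition.contDiff.comp (contDiff_const.sub (ContDiff.div_const ?_ _))
      exact (contDiff_fst.norm_sq ℝ).add (by fun_prop)
  · intro X hX
    have : 1 ≤ K * X.2 := hX.2
    show 0 < X.2
    by_contra h
    nlinarith [not_lt.1 h]

lemma cutf_mem (n : ℕ) (K : ℝ) (X : Pt n) : 0 ≤ cutf n K X ∧ cutf n K X ≤ 1 :=
  ⟨mul_nonneg (Real.smoothTransition.nonneg _) (Real.smoothTransition.nonneg _),
   mul_le_one₀ (Real.smoothTransition.le_one _) (Real.smoothTransition.nonneg _)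
    (Real.smoothTransition.le_one _)⟩

lemma cutf_ev {n : ℕ} {X : Pt n} (hX : X ∈ UHS n) : ∀ᶠ k : ℕ in atTop,
    cutf n (k + 1) X = 1 ∧ (∀ i, pdx i (cutf n (k + 1)) X = 0) ∧ pdt (cutf n (k + 1)) X = 0 := by
  have hX0 : 0 < X.2 := hX
  have h1 : ∀ᶠ k : ℕ in atTop, 2 / X.2 < (k : ℝ) := tendsto_natCast_atTop_atTop.eventually_gt_atTop _
  have h2 : ∀ᶠ k : ℕ in atTop, ‖X.1‖ ^ 2 + X.2 ^ 2 < (k : ℝ) :=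
    tendsto_natCast_atTop_atTop.eventually_gt_atTop _
  filter_upwards [h1, h2] with k h1 h2
  have hk : (0:ℝ) ≤ k := Nat.cast_nonneg k
  rw [div_lt_iff₀ hX0] at h1
  have e1 : 1 < ((k:ℝ) + 1) * X.2 - 1 := by nlinarith
  have e2 : 1 < 2 - (‖X.1‖ ^ 2 + X.2 ^ 2) / ((k:ℝ) + 1) ^ 2 := by
    have : (‖X.1‖ ^ 2 + X.2 ^ 2) / ((k:ℝ) + 1) ^ 2 < 1 := by
      rw [div_lt_one (by positivity)]; nlinarith
    linarith
  refine ⟨?_, fun i => ?_, ?_⟩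
  · simp [cutf, Real.smoothTransition.one_of_one_le e1.le, Real.smoothTransition.one_of_one_le e2.le]
  · simp [cutf_pdx, sT_deriv_zero (Or.inr e2)]
  · simp [cutf_pdt, sT_deriv_zero (Or.inr e2), sT_deriv_zero (Or.inr e1)]

lemma cutf_bd (n : ℕ) : ∃ C : ℝ, 0 ≤ C ∧ ∀ K : ℝ, 1 ≤ K → ∀ X ∈ UHS n,
    (∀ i, |pdx i (cutf n K) X| * (1 + X.2) ≤ C) ∧ |pdt (cutf n K) X| * X.2 ≤ C := by
  obtain ⟨A, hA, hb⟩ := sT_bound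
  refine ⟨14 * A, by positivity, fun K hK X hX => ?_⟩
  have ht : 0 < X.2 := hX
  have hK0 : 0 < K := by linarith
  have s1 : ∀ y, |Real.smoothTransition y| ≤ 1 := fun y => by
    rw [abs_of_nonneg (Real.smoothTransition.nonneg _)]; exact Real.smoothTransition.le_one _
  set y := 2 - (‖X.1‖ ^ 2 + X.2 ^ 2) / K ^ 2 with hy
  have main : ∀ c b : ℝ, 0 ≤ b → (‖X.1‖ ≤ 2 * K → X.2 ≤ 2 * K → |c| * b ≤ 6 * K ^ 2) →
      |Real.smoothTransition (K * X.2 - 1) * (deriv Real.smoothTransition y * (-(2 * c) / K ^ 2))| * b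
        ≤ 12 * A := by
    intro c b hb0 hcb
    by_cases h0 : y < 0
    · rw [sT_deriv_zero (Or.inl h0)]; simp; positivity
    rw [not_lt, hy, sub_nonneg, div_le_iff₀ (by positivity)] at h0
    have e1 : ‖X.1‖ ≤ 2 * K := abs_le_of_sq_le_sq' (by nlinarith [sq_nonneg X.2]) (by linarith) |>.2
    have e2 : X.2 ≤ 2 * K := abs_le_of_sq_le_sq' (by nlinarith [sq_nonneg ‖X.1‖]) (by linarith) |>.2
    have := hcb e1 e2
    have e3 : |-(2 * c) / K ^ 2| * b ≤ 12 := by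
      rw [abs_div, abs_neg, abs_mul, abs_two, abs_of_pos (show 0 < K ^ 2 by positivity),
        div_mul_eq_mul_div, div_le_iff₀ (by positivity)]
      linarith
    rw [abs_mul, abs_mul]
    calc _ ≤ 1 * (A * |-(2 * c) / K ^ 2|) * b := by gcongr <;> [exact s1 _; exact hb _]
      _ = A * (|-(2 * c) / K ^ 2| * b) := by ring
      _ ≤ A * 12 := by gcongr
      _ = _ := by ring
  constructor
  · intro i
    rw [cutf_pdx]
    have := main (X.1 i) (1 + X.2) (by positivity) (by
      intro e1 e2
      have : |X.1 i| ≤ ‖X.1‖ := PiLp.norm_apply_le X.1 i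
      calc |X.1 i| * (1 + X.2) ≤ (2 * K) * (K + 2 * K) := by gcongr; linarith
        _ = _ := by ring)
    linarith
  · rw [cutf_pdt]
    have h1 := main X.2 X.2 ht.le (fun _ e2 => by rw [abs_of_pos ht]; nlinarith)
    have h2 : |Real.smoothTransition y * (deriv Real.smoothTransition (K * X.2 - 1) * K)| * X.2 ≤ 2 * A := by
      by_cases h0 : 1 < K * X.2 - 1
      · rw [sT_deriv_zero (Or.inr h0)]; simp; positivity
      · rw [abs_mul, abs_mul, abs_of_pos hK0]
        calc _ ≤ 1 * (A * K) * X.2 := by gcongr <;> [exact s1 _; exact hb _]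
          _ = A * (K * X.2) := by ring
          _ ≤ A * 2 := by gcongr; linarith
          _ = _ := by ring
    calc _ ≤ (|Real.smoothTransition (K * X.2 - 1) * (deriv Real.smoothTransition y * (-(2 * X.2) / K ^ 2))|
        + |Real.smoothTransition y * (deriv Real.smoothTransition (K * X.2 - 1) * K)|) * X.2 := by
          gcongr; exact abs_add_le _ _
      _ ≤ _ := by linarith

lemma gradSq_eq {n : ℕ} (hn : 2 ≤ n) (u : Pt n → ℝ) (X : Pt n) :
    gradSq u X = gradxSq u X + pdt u X ^ 2 := by
  obtain ⟨d, rfl⟩ : ∃ d, n = d + 1 := ⟨n - 1, by omega⟩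
  unfold gradSq gradxSq
  rw [Fin.sum_univ_castSucc]
  congr 1
  · apply Finset.sum_congr rfl
    intro i _
    have hi : ((Fin.castSucc i : Fin (d+1)) : ℕ) < d + 1 - 1 := by simp
    unfold pd pdx bvec
    rw [dif_pos hi]
    rfl
  · unfold pd pdt bvec
    rw [dif_neg (by simp)]

lemma measurable_pdx {n : ℕ} (i : Fin (n-1)) (u : Pt n → ℝ) : Measurable (pdx i u) :=
  measurable_fderiv_apply_const ℝ u _

lemma measurable_pdt {n : ℕ} (u : Pt n → ℝ) : Measurable (pdt u) :=
  measurable_fderiv_apply_const ℝ u _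

lemma measurable_gradxSq {n : ℕ} (u : Pt n → ℝ) : Measurable (gradxSq u) := by
  unfold gradxSq
  exact Finset.measurable_fun_sum _ fun i _ => (measurable_pdx i u).pow_const 2

lemma measurable_gradSq {n : ℕ} (u : Pt n → ℝ) : Measurable (gradSq u) := by
  unfold gradSq
  exact Finset.measurable_fun_sum _ fun i _ => (measurable_fderiv_apply_const ℝ u _).pow_const 2

lemma gradSq_nonneg {n : ℕ} (u : Pt n → ℝ) (X : Pt n) : 0 ≤ gradSq u X :=
  Finset.sum_nonneg fun i _ => sq_nonneg _

lemma gradxSq_nonneg {n : ℕ} (u : Pt n → ℝ) (X : Pt n) : 0 ≤ gradxSq u X :=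
  Finset.sum_nonneg fun i _ => sq_nonneg _

lemma UHS_eq (n : ℕ) : UHS n = (univ : Set (EE n)) ×ˢ Ioi (0:ℝ) := by
  ext X; simp [UHS]

lemma restrict_UHS (n : ℕ) : (volume : Measure (Pt n)).restrict (UHS n) =
    (volume : Measure (EE n)).prod ((volume : Measure ℝ).restrict (Ioi 0)) := by
  rw [UHS_eq]
  have := Measure.prod_restrict (μ := (volume : Measure (EE n))) (ν := (volume : Measure ℝ)) univ (Ioi 0)
  rw [Measure.restrict_univ] at this
  rw [this]; rfl

lemma slice_deriv {n : ℕ} {u : Pt n → ℝ} (hu : ∀ X ∈ UHS n, DifferentiableAt ℝ u X) (q : EE n)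
    (t : ℝ) (ht : 0 < t) : HasDerivAt (fun t => u (q, t)) (pdt u (q, t)) t := by
  have h1 : HasDerivAt (fun t : ℝ => ((q, t) : Pt n)) (0, 1) t :=
    (hasDerivAt_const t q).prodMk (hasDerivAt_id t)
  exact (hu (q, t) ht).hasFDerivAt.comp_hasDerivAt t h1

lemma contOn_of_diff {n : ℕ} {u : Pt n → ℝ} (hu : ∀ X ∈ UHS n, DifferentiableAt ℝ u X) :
    ContinuousOn u (UHS n) := fun X hX => (hu X hX).continuousAt.continuousWithinAt

lemma hardy_UHS {n : ℕ} {u : Pt n → ℝ} (hu : ∀ X ∈ UHS n, DifferentiableAt ℝ u X)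
    (htr : HasTrace u (fun _ => 0)) :
    ∫⁻ X in UHS n, ENNReal.ofReal (u X ^ 2 / X.2 ^ 2) ≤
      4 * ∫⁻ X in UHS n, ENNReal.ofReal (pdt u X ^ 2) := by
  have hum : AEMeasurable u (volume.restrict (UHS n)) :=
    (contOn_of_diff hu).aemeasurable (measurableSet_UHS n)
  have hm1 : AEMeasurable (fun X : Pt n => ENNReal.ofReal (u X ^ 2 / X.2 ^ 2)) (volume.restrict (UHS n)) :=
    ((hum.pow_const 2).div (measurable_snd.pow_const 2).aemeasurable).ennreal_ofReal
  have hm2 : AEMeasurable (fun X : Pt n => ENNReal.ofReal (pdt u X ^ 2)) (volume.restrict (UHS n)) :=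
    ((measurable_pdt u).pow_const 2).aemeasurable.ennreal_ofReal
  rw [restrict_UHS] at hm1 hm2 ⊢
  rw [lintegral_prod _ hm1, lintegral_prod _ hm2, ← lintegral_const_mul' _ _ (by simp)]
  apply lintegral_mono
  intro q
  have hms : Measurable (fun t : ℝ => pdt u (q, t) ^ 2) :=
    ((measurable_pdt u).comp measurable_prodMk_left).pow_const 2
  by_cases hi : IntegrableOn (fun t : ℝ => pdt u (q, t) ^ 2) (Ioi 0)
  · exact hardy (fun t ht => slice_deriv hu q t ht) (htr q) hi
  · have : ∫⁻ t in Ioi (0:ℝ), ENNReal.ofReal (pdt u (q, t) ^ 2) = ⊤ := by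
      by_contra h
      apply hi
      refine ⟨hms.aestronglyMeasurable, ?_⟩
      rw [hasFiniteIntegral_iff_ofReal (Eventually.of_forall fun _ => sq_nonneg _)]
      exact lt_top_iff_ne_top.2 h
    dsimp only
    rw [this]; simp

lemma good_UHS {n : ℕ} {u : Pt n → ℝ} (hu : ∀ X ∈ UHS n, DifferentiableAt ℝ u X)
    (htr : HasTrace u (fun _ => 0)) (s : ℝ) (hs : 0 < s)
    (hi : IntegrableOn (fun X => u X * pdt u X * (1 / (1 + s * X.2) ^ 2)) (UHS n)) :
    0 ≤ ∫ X in UHS n, u X * pdt u X * (1 / (1 + s * X.2) ^ 2) := by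
  unfold IntegrableOn at hi
  rw [restrict_UHS] at hi ⊢
  rw [integral_prod _ hi]
  apply integral_nonneg
  intro q
  by_cases h : IntegrableOn (fun t : ℝ => u (q, t) * pdt u (q, t) * (1 / (1 + s * t) ^ 2)) (Ioi 0)
  · exact good_sign (fun t ht => slice_deriv hu q t ht) (htr q) s hs h
  · exact (integral_undef h).ge

/-- The test function `u g ψ`. -/
def tw {n : ℕ} (u : Pt n → ℝ) (s K : ℝ) (X : Pt n) : ℝ :=
  u X * (X.2 / (1 + s * X.2)) * cutf n K X

lemma tw_hasFDerivAt {n : ℕ} {u : Pt n → ℝ} {s K : ℝ} (hs : 0 < s) (hK : 1 ≤ K) {X : Pt n}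
    (hX : X ∈ UHS n) (hu : DifferentiableAt ℝ u X) :
    DifferentiableAt ℝ (tw u s K) X ∧
    (∀ i, pdx i (tw u s K) X = (X.2 / (1 + s * X.2)) *
      (pdx i u X * cutf n K X + u X * pdx i (cutf n K) X)) ∧
    pdt (tw u s K) X = (X.2 / (1 + s * X.2)) * (pdt u X * cutf n K X + u X * pdt (cutf n K) X)
      + u X * (1 / (1 + s * X.2) ^ 2) * cutf n K X := by
  have ht : 0 < X.2 := hX
  have hne : 1 + s * X.2 ≠ 0 := by positivity
  have hg : HasDerivAt (fun t : ℝ => t / (1 + s * t)) (1 / (1 + s * X.2) ^ 2) X.2 := by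
    have h1 : HasDerivAt (fun t : ℝ => 1 + s * t) (s * 1) X.2 :=
      ((hasDerivAt_id X.2).const_mul s).const_add 1
    have := (hasDerivAt_id X.2).div h1 hne
    have e : (1 * (1 + s * X.2) - id X.2 * (s * 1)) / (1 + s * X.2) ^ 2 = 1 / (1 + s * X.2) ^ 2 := by
      congr 1; simp; ring
    rw [e] at this
    exact this
  have hg' : HasFDerivAt (fun X : Pt n => X.2 / (1 + s * X.2)) _ X :=
    hg.comp_hasFDerivAt X (hasFDerivAt_snd (𝕜 := ℝ) (E := EE n) (F := ℝ) (p := X))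
  have hc : HasFDerivAt (cutf n K) (fderiv ℝ (cutf n K) X) X :=
    (((cutf_test n K hK).1.differentiable (by simp)) X).hasFDerivAt
  have h := (hu.hasFDerivAt.mul hg').mul hc
  have h' : HasFDerivAt (tw u s K) _ X := h
  refine ⟨h'.differentiableAt, ?_, ?_⟩
  · intro i
    unfold pdx
    rw [h'.fderiv]
    simp
    ring
  · unfold pdt
    rw [h'.fderiv]
    simp
    ring

lemma tw_tsupport {n : ℕ} (u : Pt n → ℝ) (s K : ℝ) : tsupport (tw u s K) ⊆ tsupport (cutf n K) := by
  apply closure_mono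
  intro X hX h
  apply hX
  simp [tw, h]

lemma tw_zero {n : ℕ} (u : Pt n → ℝ) (s K : ℝ) (hK : 1 ≤ K) {X : Pt n} (hX : X ∉ UHS n) :
    tw u s K =ᶠ[nhds X] fun _ => 0 := by
  have h1 : X ∉ tsupport (tw u s K) := fun h => hX ((cutf_test n K hK).2.2 (tw_tsupport u s K h))
  exact notMem_tsupport_iff_eventuallyEq.1 h1

lemma tw_diff {n : ℕ} {u : Pt n → ℝ} (hu : ∀ X ∈ UHS n, DifferentiableAt ℝ u X) {s K : ℝ}
    (hs : 0 < s) (hK : 1 ≤ K) : Differentiable ℝ (tw u s K) := by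
  intro X
  by_cases hX : X ∈ UHS n
  · exact (tw_hasFDerivAt hs hK hX (hu X hX)).1
  · exact ((differentiableAt_const (0:ℝ)).congr_of_eventuallyEq (tw_zero u s K hK hX))

lemma sq3 (a b c : ℝ) : (a + b + c) ^ 2 ≤ 3 * (a ^ 2 + b ^ 2 + c ^ 2) := by
  nlinarith [sq_nonneg (a - b), sq_nonneg (a - c), sq_nonneg (b - c)]

set_option maxHeartbeats 1000000 in
lemma tw_bound (n : ℕ) (hn : 2 ≤ n) (s : ℝ) (hs : 0 < s) : ∃ C : ℝ, 0 ≤ C ∧ ∀ (u : Pt n → ℝ)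
    (K : ℝ), 1 ≤ K → ∀ X ∈ UHS n, DifferentiableAt ℝ u X →
    (∀ i, pdx i (tw u s K) X ^ 2 ≤ C * (gradSq u X + u X ^ 2 / X.2 ^ 2) ∧
      pdx i (tw u s K) X ^ 2 / X.2 ≤ C * (gradSq u X + u X ^ 2 / X.2 ^ 2)) ∧
    pdt (tw u s K) X ^ 2 ≤ C * (gradSq u X + u X ^ 2 / X.2 ^ 2) := by
  obtain ⟨B, hB, hb⟩ := cutf_bd n
  set C0 : ℝ := 1 / s + 1 / s ^ 2 with hC0
  refine ⟨3 * C0 * (1 + B) ^ 2, by positivity, fun u K hK X hX hu => ?_⟩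
  have ht : 0 < X.2 := hX
  obtain ⟨-, e1, e2⟩ := tw_hasFDerivAt hs hK hX hu (u := u)
  obtain ⟨b1, b2⟩ := hb K hK X hX
  obtain ⟨c0, c1⟩ := cutf_mem n K X
  set t := X.2 with htdef
  set g := t / (1 + s * t) with hg
  set ψ := cutf n K X
  have hst : 0 < 1 + s * t := by positivity
  have hg0 : 0 < g := by positivity
  have hgt : g ≤ t := by rw [hg]; apply div_le_self ht.le; nlinarith
  have hgs : g ≤ 1 / s := by
    rw [hg, div_le_div_iff₀ hst hs]; linarith
  set Q := u X ^ 2 / t ^ 2 with hQ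
  have hQ0 : 0 ≤ Q := by positivity
  have hu2 : u X ^ 2 = Q * t ^ 2 := by rw [hQ]; field_simp
  have hE0 := gradSq_nonneg u X
  have hψ2 : ψ ^ 2 ≤ 1 := by nlinarith
  have hg2 : g ^ 2 ≤ 1 / s ^ 2 := by
    rw [show 1 / s ^ 2 = (1 / s) ^ 2 by field_simp]; gcongr
  have hg2t : g ^ 2 / t ≤ 1 / s := by
    rw [div_le_iff₀ ht]; nlinarith
  have hinv : 0 < 1 / s := by positivity
  have hinv2 : 0 < 1 / s ^ 2 := by positivity
  have hgE := gradSq_eq hn u X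
  have hgx := gradxSq_nonneg u X
  have hB1 : (1:ℝ) ≤ (1 + B) ^ 2 := by nlinarith
  have hB2 : B ^ 2 ≤ (1 + B) ^ 2 := by nlinarith
  have hC1 : 1 / s ≤ C0 := by rw [hC0]; linarith
  have hC2 : 1 / s ^ 2 ≤ C0 := by rw [hC0]; linarith
  have hfin : ∀ x y : ℝ, x ≤ C0 * gradSq u X → y ≤ C0 * B ^ 2 * Q → 3 * (x + y) ≤
      3 * C0 * (1 + B) ^ 2 * (gradSq u X + Q) := by
    intro x y hx hy
    have h1 : C0 * gradSq u X ≤ C0 * (1 + B) ^ 2 * gradSq u X := by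
      calc C0 * gradSq u X = C0 * 1 * gradSq u X := by ring
        _ ≤ _ := by gcongr
    have h2 : C0 * B ^ 2 * Q ≤ C0 * (1 + B) ^ 2 * Q := by gcongr
    calc 3 * (x + y) ≤ 3 * (C0 * (1 + B) ^ 2 * gradSq u X + C0 * (1 + B) ^ 2 * Q) := by linarith
      _ = _ := by ring
  refine ⟨fun i => ?_, ?_⟩
  · have hpi : pdx i u X ^ 2 ≤ gradSq u X := by
      have : pdx i u X ^ 2 ≤ gradxSq u X :=
        Finset.single_le_sum (f := fun i => pdx i u X ^ 2) (fun j _ => sq_nonneg _) (Finset.mem_univ i)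
      nlinarith [sq_nonneg (pdt u X)]
    have hp : (pdx i (cutf n K) X * (1 + t)) ^ 2 ≤ B ^ 2 := by
      rw [← sq_abs, abs_mul, abs_of_pos (show 0 < 1 + t by positivity)]
      have := b1 i
      gcongr
    have hx2 : (pdx i u X * ψ) ^ 2 ≤ gradSq u X := by
      rw [mul_pow]; nlinarith [sq_nonneg (pdx i u X)]
    set p := pdx i (cutf n K) X
    have hpt2 : p ^ 2 * t ^ 2 ≤ B ^ 2 := by
      nlinarith [sq_nonneg p, mul_nonneg (sq_nonneg p) ht.le]
    have hpt1 : p ^ 2 * t ≤ B ^ 2 := by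
      nlinarith [sq_nonneg p, mul_nonneg (sq_nonneg p) ht.le, mul_nonneg (sq_nonneg p) (sq_nonneg t)]
    have hexp : pdx i (tw u s K) X ^ 2 ≤ 3 * (g ^ 2 * (pdx i u X * ψ) ^ 2 + g ^ 2 * (Q * (p ^ 2 * t ^ 2))) := by
      rw [e1 i]
      have : (u X * p) ^ 2 = Q * (p ^ 2 * t ^ 2) := by rw [mul_pow, hu2]; ring
      rw [← this]
      nlinarith [mul_nonneg (sq_nonneg g) (sq_nonneg (pdx i u X * ψ - u X * p)),
        mul_nonneg (sq_nonneg g) (sq_nonneg (pdx i u X * ψ)), mul_nonneg (sq_nonneg g) (sq_nonneg (u X * p))]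
    constructor
    · refine hexp.trans (hfin _ _ ?_ ?_)
      · exact mul_le_mul (hg2.trans hC2) hx2 (by positivity) (by positivity)
      · calc _ ≤ C0 * (Q * B ^ 2) := by gcongr; exact hg2.trans hC2
          _ = _ := by ring
    · have : pdx i (tw u s K) X ^ 2 / t ≤ 3 * ((g ^ 2 / t) * (pdx i u X * ψ) ^ 2 + g ^ 2 * (Q * (p ^ 2 * t))) := by
        rw [div_le_iff₀ ht]
        refine hexp.trans (le_of_eq ?_)
        field_simp
      refine this.trans (hfin _ _ ?_ ?_)
      · exact mul_le_mul (hg2t.trans hC1) hx2 (by positivity) (by positivity)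
      · calc _ ≤ C0 * (Q * B ^ 2) := by gcongr; exact hg2.trans hC2
          _ = _ := by ring
  · have hpi : pdt u X ^ 2 ≤ gradSq u X := by linarith
    have hp : (pdt (cutf n K) X * t) ^ 2 ≤ B ^ 2 := by
      rw [← sq_abs, abs_mul, abs_of_pos ht]
      gcongr
    have hx2 : (pdt u X * ψ) ^ 2 ≤ gradSq u X := by
      rw [mul_pow]; nlinarith [sq_nonneg (pdt u X)]
    set p := pdt (cutf n K) X
    have hg' : (1 / (1 + s * t) ^ 2 * t) ^ 2 ≤ 1 / s ^ 2 := by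
      have h1 : 1 / (1 + s * t) ^ 2 * t ≤ 1 / s := by
        rw [div_mul_eq_mul_div, div_le_div_iff₀ (by positivity) hs]; nlinarith
      rw [show 1 / s ^ 2 = (1 / s) ^ 2 by field_simp]; gcongr
    set g' := 1 / (1 + s * t) ^ 2
    have hexp : pdt (tw u s K) X ^ 2 ≤ 3 * (g ^ 2 * (pdt u X * ψ) ^ 2 + g ^ 2 * (Q * (p * t) ^ 2)
        + Q * (g' * t) ^ 2 * ψ ^ 2) := by
      rw [e2]
      have h1 : g ^ 2 * (Q * (p * t) ^ 2) = (g * (u X * p)) ^ 2 := by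
        rw [mul_pow g, mul_pow (u X), hu2]; ring
      have h2 : Q * (g' * t) ^ 2 * ψ ^ 2 = (u X * g' * ψ) ^ 2 := by
        have : (u X * g' * ψ) ^ 2 = u X ^ 2 * (g' * ψ) ^ 2 := by ring
        rw [this, hu2]; ring
      rw [h1, h2, ← mul_pow]
      refine le_trans (le_of_eq ?_) (sq3 _ _ _)
      ring
    refine hexp.trans ?_
    have k1 : g ^ 2 * (pdt u X * ψ) ^ 2 ≤ C0 * gradSq u X :=
      mul_le_mul (hg2.trans hC2) hx2 (by positivity) (by positivity)
    have k2 : g ^ 2 * (Q * (p * t) ^ 2) ≤ C0 * (Q * B ^ 2) := by gcongr; exact hg2.trans hC2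
    have k3 : Q * (g' * t) ^ 2 * ψ ^ 2 ≤ Q * C0 * 1 := by gcongr; exact hg'.trans hC2
    have hC00 : 0 ≤ C0 := by positivity
    have k4 : C0 * gradSq u X ≤ C0 * (1 + B) ^ 2 * gradSq u X := by
      calc C0 * gradSq u X = C0 * 1 * gradSq u X := by ring
        _ ≤ _ := by gcongr
    have k5 : 0 ≤ C0 * Q * B := by positivity
    have k6 : C0 * (1 + B) ^ 2 * Q = C0 * Q + 2 * (C0 * Q * B) + C0 * (Q * B ^ 2) := by ring
    have k7 : 3 * C0 * (1 + B) ^ 2 * (gradSq u X + Q) =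
      3 * (C0 * (1 + B) ^ 2 * gradSq u X) + 3 * (C0 * (1 + B) ^ 2 * Q) := by ring
    rw [k7, k6]
    linarith

/-- Component functions of the flux. -/
def HH {n : ℕ} (u : Pt n → ℝ) (F G : Fin (n - 1) → Pt n → ℝ) : Option (Fin (n - 1)) → Pt n → ℝ
  | none => pdt u
  | some i => fun X => F i X + G i X

/-- The coordinate directions. -/
def dd (n : ℕ) : Option (Fin (n - 1)) → Pt n
  | none => (0, 1)
  | some i => (EuclideanSpace.single i 1, 0)

lemma integrable_of_lint {n : ℕ} {f : Pt n → ℝ} (hm : AEMeasurable f (volume.restrict (UHS n)))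
    (h0 : ∀ X ∈ UHS n, 0 ≤ f X) (h : ∫⁻ X in UHS n, ENNReal.ofReal (f X) < ⊤) :
    IntegrableOn f (UHS n) := by
  refine ⟨hm.aestronglyMeasurable, ?_⟩
  rw [hasFiniteIntegral_iff_ofReal]
  · exact h
  · exact (ae_restrict_iff' (measurableSet_UHS n)).2 (Eventually.of_forall h0)

lemma memLp_of_sq_le {α : Type*} [MeasurableSpace α] {μ : Measure α} {f g : α → ℝ}
    (hf : AEMeasurable f μ) (hg : Integrable g μ) (h : ∀ᵐ x ∂μ, f x ^ 2 ≤ g x) : MemLp f 2 μ := by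
  rw [memLp_two_iff_integrable_sq hf.aestronglyMeasurable]
  refine hg.mono' (hf.pow_const 2).aestronglyMeasurable ?_
  filter_upwards [h] with x hx
  rw [Real.norm_eq_abs, abs_of_nonneg (sq_nonneg _)]; exact hx

lemma en_EQ
    {n : ℕ}
    (hn : 2 ≤ n)
    {u : Pt n → ℝ}
    (hu : ∀ X ∈ UHS n, DifferentiableAt ℝ u X)
    (hfe : FiniteEnergy u)
    (htr : HasTrace u (fun _ => 0)) : IntegrableOn (gradSq u) (UHS n) ∧ IntegrableOn (fun X => u X ^ 2 / X.2 ^ 2) (UHS n) := by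
  have hum : AEMeasurable u (volume.restrict (UHS n)) :=
    (contOn_of_diff hu).aemeasurable (measurableSet_UHS n)
  refine ⟨integrable_of_lint (measurable_gradSq u).aemeasurable (fun X _ => gradSq_nonneg u X) hfe,
    integrable_of_lint ((hum.pow_const 2).div (measurable_snd.pow_const 2).aemeasurable)
      (fun X _ => by positivity) ?_⟩
  refine (hardy_UHS hu htr).trans_lt (ENNReal.mul_lt_top (by simp) (lt_of_le_of_lt ?_ hfe))
  apply lintegral_mono
  intro X
  apply ENNReal.ofReal_le_ofReal
  rw [gradSq_eq hn]
  linarith [gradxSq_nonneg u X]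

lemma en_memLp
    {n : ℕ}
    (hn : 2 ≤ n)
    {u : Pt n → ℝ}
    (hu : ∀ X ∈ UHS n, DifferentiableAt ℝ u X)
    (hfe : FiniteEnergy u)
    (htr : HasTrace u (fun _ => 0)) {s K : ℝ} (hs : 0 < s) (hK : 1 ≤ K) (i : Option (Fin (n - 1))) :
    MemLp (fun X => fderiv ℝ (tw u s K) X (dd n i)) 2 volume := by
  obtain ⟨hE, hQ⟩ := en_EQ hn hu hfe htr
  obtain ⟨C, hC, hb⟩ := tw_bound n hn s hs
  have hz : ∀ X, X ∉ UHS n → fderiv ℝ (tw u s K) X (dd n i) = 0 := by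
    intro X hX
    rw [(tw_zero u s K hK hX).fderiv_eq]; simp
  have : (fun X => fderiv ℝ (tw u s K) X (dd n i)) =
      (UHS n).indicator (fun X => fderiv ℝ (tw u s K) X (dd n i)) := by
    ext X
    by_cases hX : X ∈ UHS n
    · simp [hX]
    · simp [hX, hz X hX]
  rw [this, memLp_indicator_iff_restrict (measurableSet_UHS n)]
  refine memLp_of_sq_le (measurable_fderiv_apply_const ℝ _ _).aemeasurable ((hE.add hQ).const_mul C) ?_
  refine (ae_restrict_iff' (measurableSet_UHS n)).2 (Eventually.of_forall fun X hX => ?_)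
  have hbb := hb u K hK X hX (hu X hX)
  match i with
  | none => exact hbb.2
  | some i => exact (hbb.1 i).1

lemma en_H
    {n : ℕ}
    (hn : 2 ≤ n)
    {u : Pt n → ℝ}
    (hu : ∀ X ∈ UHS n, DifferentiableAt ℝ u X)
    (hfe : FiniteEnergy u)
    (htr : HasTrace u (fun _ => 0))
    {Cf : ℝ}
    {F G : Fin (n - 1) → Pt n → ℝ}
    {P : Pt n → ℝ}
    (hFm : ∀ i, Measurable (F i))
    (hGm : ∀ i, AEMeasurable (G i) (volume.restrict (UHS n)))
    (hPm : AEMeasurable P (volume.restrict (UHS n)))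
    (hF2 : ∀ X ∈ UHS n, ∀ i, F i X ^ 2 ≤ Cf * gradSq u X)
    (hG : ∀ X ∈ UHS n, ∑ i, G i X ^ 2 ≤ P X)
    (hP : ∫⁻ X in UHS n, ENNReal.ofReal (P X * X.2) < ⊤) (hP0 : ∀ X ∈ UHS n, 0 ≤ P X) (i : Option (Fin (n - 1))) (K : Set (Pt n)) (hKc : IsCompact K)
    (hKs : K ⊆ UHS n) : MemLp (HH u F G i) 2 (volume.restrict K) := by
  obtain ⟨hE, hQ⟩ := en_EQ hn hu hfe htr
  have hmono : (volume : Measure (Pt n)).restrict K ≤ volume.restrict (UHS n) :=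
    Measure.restrict_mono hKs le_rfl
  have hall : ∀ {p : Pt n → Prop}, (∀ X ∈ UHS n, p X) → ∀ᵐ X ∂(volume.restrict K), p X := by
    intro p hp
    exact (ae_restrict_iff' hKc.measurableSet).2 (Eventually.of_forall fun X hX => hp X (hKs hX))
  match i with
  | none =>
    refine memLp_of_sq_le (measurable_pdt u).aemeasurable (hE.mono_set hKs) (hall ?_)
    intro X hX
    simp only [HH]
    rw [gradSq_eq hn]; linarith [gradxSq_nonneg u X]
  | some i =>
    have h1 : MemLp (F i) 2 (volume.restrict K) :=
      memLp_of_sq_le (hFm i).aemeasurable ((hE.mono_set hKs).const_mul Cf)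
        (hall fun X hX => hF2 X hX i)
    have hR : IntegrableOn (fun X => P X * X.2) (UHS n) :=
      integrable_of_lint (hPm.mul measurable_snd.aemeasurable)
        (fun X hX => mul_nonneg (hP0 X hX) (le_of_lt hX)) hP
    obtain ⟨c, hc, hcK⟩ : ∃ c : ℝ, 0 < c ∧ ∀ X ∈ K, c ≤ X.2 := by
      rcases K.eq_empty_or_nonempty with h | h
      · exact ⟨1, one_pos, by simp [h]⟩
      · obtain ⟨Y, hY, hm⟩ := hKc.exists_isMinOn h (continuous_snd.continuousOn)
        exact ⟨Y.2, hKs hY, fun X hX => hm hX⟩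
    have h2 : MemLp (G i) 2 (volume.restrict K) := by
      refine memLp_of_sq_le ((hGm i).mono_measure hmono) ((hR.mono_set hKs).const_mul (1 / c)) ?_
      refine (ae_restrict_iff' hKc.measurableSet).2 (Eventually.of_forall fun X hX => ?_)
      have h3 : G i X ^ 2 ≤ P X := le_trans
        (Finset.single_le_sum (f := fun i => G i X ^ 2) (fun j _ => sq_nonneg _) (Finset.mem_univ i))
        (hG X (hKs hX))
      rw [one_div, inv_mul_eq_div, le_div_iff₀ hc]
      exact mul_le_mul h3 (hcK X hX) hc.le (hP0 X (hKs hX))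
    exact h1.add h2


lemma ab_le (a b : ℝ) : |a * b| ≤ a ^ 2 + b ^ 2 := by
  rw [abs_mul]
  nlinarith [sq_abs a, sq_abs b, sq_nonneg (|a| - |b|), sq_nonneg a, sq_nonneg b]

lemma en_limit
    {n : ℕ}
    (hn : 2 ≤ n)
    {u : Pt n → ℝ}
    (hu : ∀ X ∈ UHS n, DifferentiableAt ℝ u X)
    (hfe : FiniteEnergy u)
    (htr : HasTrace u (fun _ => 0))
    {Cf : ℝ}
    (hCf : 0 ≤ Cf)
    {F G : Fin (n - 1) → Pt n → ℝ}
    {P : Pt n → ℝ}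
    (hFm : ∀ i, Measurable (F i))
    (hGm : ∀ i, AEMeasurable (G i) (volume.restrict (UHS n)))
    (hPm : AEMeasurable P (volume.restrict (UHS n)))
    (hP0 : ∀ X ∈ UHS n, 0 ≤ P X)
    (hF2 : ∀ X ∈ UHS n, ∀ i, F i X ^ 2 ≤ Cf * gradSq u X)
    (hG : ∀ X ∈ UHS n, ∑ i, G i X ^ 2 ≤ P X)
    (hP : ∫⁻ X in UHS n, ENNReal.ofReal (P X * X.2) < ⊤)
    (hyp : ∀ φ, TestFun (UHS n) φ →
    ∫ X in UHS n, (∑ i, (F i X + G i X) * pdx i φ X) + pdt u X * pdt φ X = 0) {s : ℝ} (hs : 0 < s) :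
    IntegrableOn (fun X => (X.2 / (1 + s * X.2)) * ((∑ i, (F i X + G i X) * pdx i u X) + pdt u X ^ 2)
      + u X * pdt u X * (1 / (1 + s * X.2) ^ 2)) (UHS n) ∧
    ∫ X in UHS n, ((X.2 / (1 + s * X.2)) * ((∑ i, (F i X + G i X) * pdx i u X) + pdt u X ^ 2)
      + u X * pdt u X * (1 / (1 + s * X.2) ^ 2)) = 0 := by
  obtain ⟨hE, hQ⟩ := en_EQ hn hu hfe htr
  have hR : IntegrableOn (fun X => P X * X.2) (UHS n) :=
    integrable_of_lint (hPm.mul measurable_snd.aemeasurable)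
      (fun X hX => mul_nonneg (hP0 X hX) (le_of_lt hX)) hP
  obtain ⟨C, hC, hb⟩ := tw_bound n hn s hs
  set I : ℕ → Pt n → ℝ := fun k X => (∑ i, (F i X + G i X) * pdx i (tw u s (k + 1)) X) +
    pdt u X * pdt (tw u s (k + 1)) X with hI
  have hK : ∀ k : ℕ, (1:ℝ) ≤ (k:ℝ) + 1 := fun k => by linarith [(Nat.cast_nonneg k : (0:ℝ) ≤ k)]
  have hopt : ∀ φ : Pt n → ℝ, ∀ X, ∑ i, HH u F G i X * fderiv ℝ φ X (dd n i) =
      (∑ i, (F i X + G i X) * pdx i φ X) + pdt u X * pdt φ X := by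
    intro φ X
    rw [Fintype.sum_option, add_comm]; rfl
  have hI0 : ∀ k, ∫ X in UHS n, I k X = 0 := by
    intro k
    have := test_UHS (dd n) (HH u F G)
      (fun i K h1 h2 => en_H hn hu hfe htr hFm hGm hPm hF2 hG hP hP0 i K h1 h2)
      (fun φ hφ => by simp_rw [hopt]; exact hyp φ hφ)
      (tw_diff hu hs (hK k))
      ((cutf_test n _ (hK k)).2.1.of_isClosed_subset (isClosed_tsupport _) (tw_tsupport u s _))
      ((tw_tsupport u s _).trans (cutf_test n _ (hK k)).2.2)
      (fun i => en_memLp hn hu hfe htr hs (hK k) i)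
    simp_rw [hopt] at this
    exact this
  set A : ℝ := Cf + 2 * C + 1 with hA
  have hA0 : 0 ≤ A := by positivity
  set bound : Pt n → ℝ := fun X => ((n - 1 : ℕ) * A + A) * (gradSq u X + u X ^ 2 / X.2 ^ 2 + P X * X.2)
    with hbound
  have hbi : IntegrableOn bound (UHS n) := ((hE.add hQ).add hR).const_mul _
  have hIm : ∀ k, AEStronglyMeasurable (I k) (volume.restrict (UHS n)) := by
    intro k
    refine AEMeasurable.aestronglyMeasurable ?_
    refine AEMeasurable.add ?_ ((measurable_pdt u).mul (measurable_pdt _)).aemeasurable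
    refine Finset.aemeasurable_fun_sum _ fun i _ => ?_
    exact ((hFm i).aemeasurable.add (hGm i)).mul (measurable_pdx i _).aemeasurable
  have hIb : ∀ k, ∀ X ∈ UHS n, ‖I k X‖ ≤ bound X := by
    intro k X hX
    have ht : 0 < X.2 := hX
    obtain ⟨b1, b2⟩ := hb u _ (hK k) X hX (hu X hX)
    have hE0 := gradSq_nonneg u X
    have hQ0 : 0 ≤ u X ^ 2 / X.2 ^ 2 := by positivity
    have hR0 : 0 ≤ P X * X.2 := mul_nonneg (hP0 X hX) ht.le
    set D := gradSq u X + u X ^ 2 / X.2 ^ 2 + P X * X.2 with hD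
    have hCD : C * (gradSq u X + u X ^ 2 / X.2 ^ 2) ≤ C * D := by gcongr; linarith
    have hED : gradSq u X ≤ D := by linarith
    have hPD : P X * X.2 ≤ D := by linarith
    have hD0 : 0 ≤ D := by linarith
    have t1 : ∀ i, |(F i X + G i X) * pdx i (tw u s (k + 1)) X| ≤ A * D := by
      intro i
      rw [add_mul]
      refine (abs_add_le _ _).trans ?_
      have e1 := ab_le (F i X) (pdx i (tw u s (k + 1)) X)
      have e2 := hF2 X hX i
      have e3 : |G i X * pdx i (tw u s (k + 1)) X| ≤ G i X ^ 2 * X.2 + pdx i (tw u s (k + 1)) X ^ 2 / X.2 := by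
        have := ab_le (G i X * Real.sqrt X.2) (pdx i (tw u s (k + 1)) X / Real.sqrt X.2)
        have hsq : Real.sqrt X.2 ≠ 0 := (Real.sqrt_pos.2 ht).ne'
        rw [mul_pow, div_pow, Real.sq_sqrt ht.le] at this
        refine le_trans (le_of_eq ?_) this
        congr 1
        field_simp
      have e4 : G i X ^ 2 ≤ P X := le_trans
        (Finset.single_le_sum (f := fun i => G i X ^ 2) (fun j _ => sq_nonneg _) (Finset.mem_univ i))
        (hG X hX)
      have e5 : G i X ^ 2 * X.2 ≤ P X * X.2 := by gcongr
      have e6 : Cf * gradSq u X ≤ Cf * D := by gcongr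
      have := b1 i
      have e7 : A * D = Cf * D + C * D + C * D + D := by rw [hA]; ring
      rw [e7]
      linarith [this.1, this.2]
    have t2 : |pdt u X * pdt (tw u s (k + 1)) X| ≤ A * D := by
      have e1 := ab_le (pdt u X) (pdt (tw u s (k + 1)) X)
      have e2 : pdt u X ^ 2 ≤ gradSq u X := by
        rw [gradSq_eq hn]; linarith [gradxSq_nonneg u X]
      have e6 : 0 ≤ Cf * D := by positivity
      have e8 : 0 ≤ C * D := by positivity
      have e7 : A * D = Cf * D + C * D + C * D + D := by rw [hA]; ring
      rw [e7]
      linarith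
    rw [Real.norm_eq_abs]
    refine (abs_add_le _ _).trans ?_
    have t3 : |∑ i, (F i X + G i X) * pdx i (tw u s (k + 1)) X| ≤ (n - 1 : ℕ) * (A * D) := by
      refine (Finset.abs_sum_le_sum_abs _ _).trans ?_
      refine (Finset.sum_le_sum fun i _ => t1 i).trans ?_
      simp
    simp only [hbound]
    rw [← hD]
    linarith
  set L : Pt n → ℝ := fun X => (X.2 / (1 + s * X.2)) * ((∑ i, (F i X + G i X) * pdx i u X) + pdt u X ^ 2)
      + u X * pdt u X * (1 / (1 + s * X.2) ^ 2) with hL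
  have hlim : ∀ X ∈ UHS n, Tendsto (fun k => I k X) atTop (nhds (L X)) := by
    intro X hX
    refine tendsto_const_nhds.congr' ?_
    filter_upwards [cutf_ev hX] with k hk
    obtain ⟨h1, h2, h3⟩ := hk
    obtain ⟨-, e1, e2⟩ := tw_hasFDerivAt hs (hK k) hX (hu X hX) (u := u)
    simp only [hI, hL]
    rw [e2, h3, h1]
    simp_rw [e1, h2, h1]
    rw [mul_add, Finset.mul_sum]
    rw [add_assoc]
    congr 1
    · apply Finset.sum_congr rfl
      intro i _
      ring
    · ring
  have hall : ∀ {p : Pt n → Prop}, (∀ X ∈ UHS n, p X) → ∀ᵐ X ∂(volume.restrict (UHS n)), p X := by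
    intro p hp
    exact (ae_restrict_iff' (measurableSet_UHS n)).2 (Eventually.of_forall hp)
  have hdct := tendsto_integral_of_dominated_convergence bound hIm hbi (fun k => hall (hIb k)) (hall hlim)
  simp_rw [hI0] at hdct
  have hLm : AEStronglyMeasurable L (volume.restrict (UHS n)) :=
    aestronglyMeasurable_of_tendsto_ae atTop hIm (hall hlim)
  refine ⟨?_, tendsto_nhds_unique hdct tendsto_const_nhds⟩
  refine Integrable.mono' hbi hLm (hall fun X hX => ?_)
  exact le_of_tendsto (hlim X hX).norm (Eventually.of_forall fun k => hIb k X hX)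

lemma en_s
    {n : ℕ}
    (hn : 2 ≤ n)
    {u : Pt n → ℝ}
    (hu : ∀ X ∈ UHS n, DifferentiableAt ℝ u X)
    (hfe : FiniteEnergy u)
    (htr : HasTrace u (fun _ => 0))
    {lam' Cf : ℝ}
    (hl : 0 < lam')
    (hl1 : lam' ≤ 1)
    (hCf : 0 ≤ Cf)
    {F G : Fin (n - 1) → Pt n → ℝ}
    {P : Pt n → ℝ}
    (hFm : ∀ i, Measurable (F i))
    (hGm : ∀ i, AEMeasurable (G i) (volume.restrict (UHS n)))
    (hPm : AEMeasurable P (volume.restrict (UHS n)))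
    (hP0 : ∀ X ∈ UHS n, 0 ≤ P X)
    (hF1 : ∀ X ∈ UHS n, lam' * gradxSq u X ≤ ∑ i, F i X * pdx i u X)
    (hF2 : ∀ X ∈ UHS n, ∀ i, F i X ^ 2 ≤ Cf * gradSq u X)
    (hG : ∀ X ∈ UHS n, ∑ i, G i X ^ 2 ≤ P X)
    (hP : ∫⁻ X in UHS n, ENNReal.ofReal (P X * X.2) < ⊤)
    (hyp : ∀ φ, TestFun (UHS n) φ →
    ∫ X in UHS n, (∑ i, (F i X + G i X) * pdx i φ X) + pdt u X * pdt φ X = 0) {s : ℝ} (hs : 0 < s) :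
    ∫⁻ X in UHS n, ENNReal.ofReal (gradSq u X * (X.2 / (1 + s * X.2))) ≤
      ENNReal.ofReal (1 / lam' ^ 2) * ∫⁻ X in UHS n, ENNReal.ofReal (P X * X.2) := by
  obtain ⟨hE, hQ⟩ := en_EQ hn hu hfe htr
  have hR : IntegrableOn (fun X => P X * X.2) (UHS n) :=
    integrable_of_lint (hPm.mul measurable_snd.aemeasurable)
      (fun X hX => mul_nonneg (hP0 X hX) (le_of_lt hX)) hP
  obtain ⟨hLi, hL0⟩ := en_limit hn hu hfe htr hCf hFm hGm hPm hP0 hF2 hG hP hyp hs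
  have hall : ∀ {p : Pt n → Prop}, (∀ X ∈ UHS n, p X) → ∀ᵐ X ∂(volume.restrict (UHS n)), p X := by
    intro p hp
    exact (ae_restrict_iff' (measurableSet_UHS n)).2 (Eventually.of_forall hp)
  have hum : AEMeasurable u (volume.restrict (UHS n)) :=
    (contOn_of_diff hu).aemeasurable (measurableSet_UHS n)
  -- facts on g
  have hg : ∀ X ∈ UHS n, 0 ≤ X.2 / (1 + s * X.2) ∧ X.2 / (1 + s * X.2) ≤ X.2 ∧
      X.2 / (1 + s * X.2) ≤ 1 / s ∧ 0 ≤ (1 / (1 + s * X.2) ^ 2) * X.2 ∧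
      (1 / (1 + s * X.2) ^ 2) * X.2 ≤ 1 / s := by
    intro X hX
    have ht : 0 < X.2 := hX
    have hst : 0 < 1 + s * X.2 := by positivity
    refine ⟨by positivity, ?_, ?_, by positivity, ?_⟩
    · apply div_le_self ht.le; nlinarith
    · rw [div_le_div_iff₀ hst hs]; linarith
    · rw [div_mul_eq_mul_div, div_le_div_iff₀ (by positivity) hs]; nlinarith
  have hgm : Measurable (fun X : Pt n => X.2 / (1 + s * X.2)) := by fun_prop
  have hgm' : Measurable (fun X : Pt n => 1 / (1 + s * X.2) ^ 2) := by fun_prop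
  -- integrability of J
  have hJi : IntegrableOn (fun X => u X * pdt u X * (1 / (1 + s * X.2) ^ 2)) (UHS n) := by
    refine Integrable.mono' ((hE.add hQ).const_mul (1 / s))
      ((hum.mul (measurable_pdt u).aemeasurable).mul hgm'.aemeasurable).aestronglyMeasurable
      (hall fun X hX => ?_)
    have ht : 0 < X.2 := hX
    obtain ⟨-, -, -, g4, g5⟩ := hg X hX
    have e1 := ab_le (pdt u X) (u X / X.2)
    have e2 : pdt u X ^ 2 ≤ gradSq u X := by
      rw [gradSq_eq hn]; linarith [gradxSq_nonneg u X]
    have e3 : u X * pdt u X * (1 / (1 + s * X.2) ^ 2) =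
        ((1 / (1 + s * X.2) ^ 2) * X.2) * (pdt u X * (u X / X.2)) := by field_simp
    rw [e3, Real.norm_eq_abs, abs_mul, abs_of_nonneg g4]
    rw [div_pow] at e1
    exact mul_le_mul g5 (by simp only [Pi.add_apply]; linarith) (abs_nonneg _) (by positivity)
  have hJ := good_UHS hu htr s hs hJi
  -- integrability of E g
  have hEg : IntegrableOn (fun X => gradSq u X * (X.2 / (1 + s * X.2))) (UHS n) := by
    refine Integrable.mono' (hE.const_mul (1 / s))
      ((measurable_gradSq u).mul hgm).aestronglyMeasurable (hall fun X hX => ?_)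
    obtain ⟨g1, -, g3, -⟩ := hg X hX
    rw [Real.norm_eq_abs, abs_of_nonneg (mul_nonneg (gradSq_nonneg _ _) g1), mul_comm]
    exact mul_le_mul_of_nonneg_right g3 (gradSq_nonneg _ _)
  -- pointwise inequality
  have hpt : ∀ X ∈ UHS n, (lam' / 2) * (gradSq u X * (X.2 / (1 + s * X.2)))
      - (1 / (2 * lam')) * (P X * X.2) ≤
      (X.2 / (1 + s * X.2)) * ((∑ i, (F i X + G i X) * pdx i u X) + pdt u X ^ 2) := by
    intro X hX
    obtain ⟨g1, g2, -⟩ := hg X hX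
    set g := X.2 / (1 + s * X.2)
    have e1 := hF1 X hX
    have e2 : -(lam' / 2 * gradxSq u X) - (1 / (2 * lam')) * P X ≤ ∑ i, G i X * pdx i u X := by
      have h1 : ∀ i, -(lam' / 2 * pdx i u X ^ 2) - (1 / (2 * lam')) * G i X ^ 2 ≤ G i X * pdx i u X := by
        intro i
        have : G i X * pdx i u X - (-(lam' / 2 * pdx i u X ^ 2) - (1 / (2 * lam')) * G i X ^ 2) =
          (1 / (2 * lam')) * (lam' * pdx i u X + G i X) ^ 2 := by field_simp; ring
        have h2 : 0 ≤ (1 / (2 * lam')) * (lam' * pdx i u X + G i X) ^ 2 := by positivity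
        linarith
      have h2 := Finset.sum_le_sum fun i (_ : i ∈ Finset.univ) => h1 i
      rw [Finset.sum_sub_distrib, Finset.sum_neg_distrib, ← Finset.mul_sum, ← Finset.mul_sum] at h2
      have h3 : (1 / (2 * lam')) * ∑ i, G i X ^ 2 ≤ (1 / (2 * lam')) * P X := by
        gcongr; exact hG X hX
      unfold gradxSq
      linarith
    have e3 : ∑ i, (F i X + G i X) * pdx i u X = ∑ i, F i X * pdx i u X + ∑ i, G i X * pdx i u X := by
      rw [← Finset.sum_add_distrib]; congr 1; ext i; ring
    have e4 : lam' / 2 * pdt u X ^ 2 ≤ pdt u X ^ 2 := by nlinarith [sq_nonneg (pdt u X)]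
    have e5 : lam' / 2 * gradSq u X - (1 / (2 * lam')) * P X ≤
        (∑ i, (F i X + G i X) * pdx i u X) + pdt u X ^ 2 := by
      rw [e3, gradSq_eq hn]; linarith
    have e6 := mul_le_mul_of_nonneg_left e5 g1
    have e7 : (1 / (2 * lam')) * P X * g ≤ (1 / (2 * lam')) * P X * X.2 := by
      have := hP0 X hX
      gcongr
    linarith
  have hIntg := integral_mono_ae ((hEg.const_mul (lam' / 2)).sub (hR.const_mul (1 / (2 * lam'))))
    (hLi.sub hJi) (hall fun X hX => by
      have := hpt X hX
      simp only [Pi.sub_apply]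
      linarith)
  have i1 : ∫ X in UHS n, ((fun X => (lam' / 2) * (gradSq u X * (X.2 / (1 + s * X.2)))) -
      fun X => (1 / (2 * lam')) * (P X * X.2)) X = (lam' / 2) * (∫ X in UHS n, gradSq u X * (X.2 / (1 + s * X.2)))
      - (1 / (2 * lam')) * ∫ X in UHS n, P X * X.2 := by
    rw [integral_sub' (hEg.const_mul (lam' / 2)) (hR.const_mul (1 / (2 * lam'))),
      integral_const_mul, integral_const_mul]
  rw [i1, integral_sub' hLi hJi, hL0] at hIntg
  have hfin : ∫ X in UHS n, gradSq u X * (X.2 / (1 + s * X.2)) ≤ (1 / lam' ^ 2) * ∫ X in UHS n, P X * X.2 := by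
    have : (lam' / 2) * (∫ X in UHS n, gradSq u X * (X.2 / (1 + s * X.2))) ≤
      (1 / (2 * lam')) * ∫ X in UHS n, P X * X.2 := by linarith
    generalize (∫ X in UHS n, gradSq u X * (X.2 / (1 + s * X.2))) = x at this ⊢
    generalize (∫ X in UHS n, P X * X.2) = y at this ⊢
    have h2 := mul_le_mul_of_nonneg_left this (show 0 ≤ 2 / lam' by positivity)
    calc x = 2 / lam' * ((lam' / 2) * x) := by field_simp
      _ ≤ _ := h2
      _ = _ := by field_simp
  rw [← ofReal_integral_eq_lintegral_ofReal hEg (hall fun X hX =>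
      mul_nonneg (gradSq_nonneg _ _) (hg X hX).1),
    ← ofReal_integral_eq_lintegral_ofReal hR (hall fun X hX =>
      mul_nonneg (hP0 X hX) (le_of_lt hX)), ← ENNReal.ofReal_mul (by positivity)]
  exact ENNReal.ofReal_le_ofReal hfin

lemma en_final
    {n : ℕ}
    (hn : 2 ≤ n)
    {u : Pt n → ℝ}
    (hu : ∀ X ∈ UHS n, DifferentiableAt ℝ u X)
    (hfe : FiniteEnergy u)
    (htr : HasTrace u (fun _ => 0))
    {lam' Cf : ℝ}
    (hl : 0 < lam')
    (hl1 : lam' ≤ 1)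
    (hCf : 0 ≤ Cf)
    {F G : Fin (n - 1) → Pt n → ℝ}
    {P : Pt n → ℝ}
    (hFm : ∀ i, Measurable (F i))
    (hGm : ∀ i, AEMeasurable (G i) (volume.restrict (UHS n)))
    (hPm : AEMeasurable P (volume.restrict (UHS n)))
    (hP0 : ∀ X ∈ UHS n, 0 ≤ P X)
    (hF1 : ∀ X ∈ UHS n, lam' * gradxSq u X ≤ ∑ i, F i X * pdx i u X)
    (hF2 : ∀ X ∈ UHS n, ∀ i, F i X ^ 2 ≤ Cf * gradSq u X)
    (hG : ∀ X ∈ UHS n, ∑ i, G i X ^ 2 ≤ P X)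
    (hyp : ∀ φ, TestFun (UHS n) φ →
    ∫ X in UHS n, (∑ i, (F i X + G i X) * pdx i φ X) + pdt u X * pdt φ X = 0) :
    ∫⁻ X in UHS n, ENNReal.ofReal (gradSq u X) * ENNReal.ofReal X.2 ≤
      ENNReal.ofReal (1 / lam' ^ 2) * ∫⁻ X in UHS n, ENNReal.ofReal (P X * X.2) := by
  by_cases hP : ∫⁻ X in UHS n, ENNReal.ofReal (P X * X.2) < ⊤
  swap
  · rw [not_lt_top_iff.1 hP, ENNReal.mul_top]
    · exact le_top
    · simp only [ne_eq, ENNReal.ofReal_eq_zero, not_le]; positivity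
  have hs : ∀ k : ℕ, (0:ℝ) < 1 / ((k:ℝ) + 1) := fun k => by positivity
  have key := fun k : ℕ => en_s hn hu hfe htr hl hl1 hCf hFm hGm hPm hP0 hF1 hF2 hG hP hyp (hs k)
  have hlim : ∀ X ∈ UHS n, Tendsto (fun k : ℕ => ENNReal.ofReal (gradSq u X * (X.2 / (1 + 1 / ((k:ℝ) + 1) * X.2))))
      atTop (nhds (ENNReal.ofReal (gradSq u X) * ENNReal.ofReal X.2)) := by
    intro X hX
    rw [← ENNReal.ofReal_mul (gradSq_nonneg u X)]
    refine ENNReal.tendsto_ofReal (tendsto_const_nhds.mul ?_)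
    have h1 : Tendsto (fun k : ℕ => 1 + 1 / ((k:ℝ) + 1) * X.2) atTop (nhds (1 + 0 * X.2)) :=
      tendsto_const_nhds.add (tendsto_one_div_add_atTop_nhds_zero_nat.mul tendsto_const_nhds)
    have h2 : Tendsto (fun k : ℕ => X.2 / (1 + 1 / ((k:ℝ) + 1) * X.2)) atTop (nhds (X.2 / (1 + 0 * X.2))) :=
      tendsto_const_nhds.div h1 (by simp)
    simpa using h2
  calc ∫⁻ X in UHS n, ENNReal.ofReal (gradSq u X) * ENNReal.ofReal X.2
      = ∫⁻ X in UHS n, liminf (fun k : ℕ => ENNReal.ofReal (gradSq u X * (X.2 / (1 + 1 / ((k:ℝ) + 1) * X.2)))) atTop := by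
        refine setLIntegral_congr_fun (measurableSet_UHS n) fun X hX => ?_
        exact (hlim X hX).liminf_eq.symm
    _ ≤ liminf (fun k : ℕ => ∫⁻ X in UHS n, ENNReal.ofReal (gradSq u X * (X.2 / (1 + 1 / ((k:ℝ) + 1) * X.2)))) atTop := by
        apply lintegral_liminf_le
        intro k
        refine ((measurable_gradSq u).mul ?_).ennreal_ofReal
        fun_prop
    _ ≤ _ := by
        refine (liminf_le_liminf (Eventually.of_forall key)).trans ?_
        simp


lemma integrable_test {n : ℕ} {h φ : Pt n → ℝ} (hφ : TestFun (UHS n) φ)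
    (hh : MemLp h 2 (volume.restrict (tsupport φ))) (e : Pt n) :
    IntegrableOn (fun X => h X * fderiv ℝ φ X e) (UHS n) := by
  have hK : IsCompact (tsupport φ) := hφ.2.1
  have hc : Continuous (fun X => fderiv ℝ φ X e) :=
    (hφ.1.continuous_fderiv (by simp)).clm_apply continuous_const
  have hcs : HasCompactSupport (fun X => fderiv ℝ φ X e) := hφ.2.1.fderiv_apply ℝ e
  have : IsFiniteMeasureOnCompacts (volume : Measure (Pt n)) := (haar_Pt n).toIsFiniteMeasureOnCompacts
  have h2 : MemLp (fun X => fderiv ℝ φ X e) 2 (volume.restrict (tsupport φ)) :=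
    (hc.memLp_of_hasCompactSupport hcs).restrict _
  have h3 : IntegrableOn (fun X => h X * fderiv ℝ φ X e) (tsupport φ) := hh.integrable_mul h2
  have h4 : Integrable (fun X => h X * fderiv ℝ φ X e) := by
    refine (integrableOn_iff_integrable_of_support_subset ?_).1 h3
    intro X hX
    by_contra hn
    apply hX
    have : fderiv ℝ φ X = 0 := by
      by_contra h
      exact hn (support_fderiv_subset ℝ h)
    simp [this]
  exact h4.integrableOn

lemma measurable_gradxA {n m : ℕ} (A : Pt n → Fin m → Fin m → ℝ) : Measurable (gradxA A) := by
  unfold gradxA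
  refine Measurable.sqrt ?_
  exact Finset.measurable_fun_sum _ fun p _ => Finset.measurable_fun_sum _ fun q _ => measurable_gradxSq _

lemma gradxA_sq {n m : ℕ} (A : Pt n → Fin m → Fin m → ℝ) (X : Pt n) :
    gradxA A X ^ 2 = ∑ p, ∑ q, gradxSq (fun Y => A Y p q) X := by
  unfold gradxA
  rw [Real.sq_sqrt]
  exact Finset.sum_nonneg fun p _ => Finset.sum_nonneg fun q _ => gradxSq_nonneg _ _

/-- The energy estimate for one component. -/
lemma energy_component {n : ℕ} (hn : 2 ≤ n) {lam Lam : ℝ} (hlam : 0 < lam) (_hLam : lam ≤ Lam)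
    {Bpar : Pt n → Fin (n - 1) → Fin (n - 1) → ℝ} {M : ℝ} {f : EE n → ℝ}
    {v η : Fin (n - 1) → Pt n → ℝ} (hell : EllipticOn (UHS n) Bpar lam Lam)
    (hset : WCSetup Bpar M f v η) (m : Fin (n - 1)) :
    ∫⁻ X in UHS n, ENNReal.ofReal (gradSq (η m) X) * ENNReal.ofReal X.2 ≤
      ENNReal.ofReal (1 / (min lam 1) ^ 2) *
        ∫⁻ X in UHS n, ENNReal.ofReal (gradxA Bpar X ^ 2 * (∑ j, (v j X + η j X) ^ 2) * X.2) := by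
  obtain ⟨hLip, -, -, -, -, hv, hη⟩ := hset
  obtain ⟨hu, hfe, htr, hweak⟩ := hη m
  have hl : 0 < min lam 1 := lt_min hlam one_pos
  have hBm : ∀ i j, Measurable (fun X => Bpar X i j) := fun i j => by
    have h1 : Continuous (fun X => Bpar X i j) :=
      (continuous_apply j).comp ((continuous_apply i).comp hLip.continuous)
    exact h1.measurable
  have hWm : ∀ j, AEMeasurable (fun X => v j X + η j X) (volume.restrict (UHS n)) := fun j =>
    ((contOn_of_diff (hv j).1.1).add (contOn_of_diff (hη j).1)).aemeasurable (measurableSet_UHS n)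
  set F : Fin (n - 1) → Pt n → ℝ := fun i X => ∑ j, Bpar X i j * pdx j (η m) X with hF
  set G : Fin (n - 1) → Pt n → ℝ := fun i X =>
    ∑ j, pdx m (fun Z => Bpar Z i j) X * (v j X + η j X) with hG
  set P : Pt n → ℝ := fun X => gradxA Bpar X ^ 2 * (∑ j, (v j X + η j X) ^ 2) with hP
  have hFm : ∀ i, Measurable (F i) := fun i =>
    Finset.measurable_fun_sum _ fun j _ => (hBm i j).mul (measurable_pdx j _)
  have hGm : ∀ i, AEMeasurable (G i) (volume.restrict (UHS n)) := fun i =>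
    Finset.aemeasurable_fun_sum _ fun j _ => (measurable_pdx m _).aemeasurable.mul (hWm j)
  have hPm : AEMeasurable P (volume.restrict (UHS n)) :=
    ((measurable_gradxA Bpar).pow_const 2).aemeasurable.mul
      (Finset.aemeasurable_fun_sum _ fun j _ => (hWm j).pow_const 2)
  have hP0 : ∀ X ∈ UHS n, 0 ≤ P X := fun X _ =>
    mul_nonneg (sq_nonneg _) (Finset.sum_nonneg fun j _ => sq_nonneg _)
  have hF1 : ∀ X ∈ UHS n, min lam 1 * gradxSq (η m) X ≤ ∑ i, F i X * pdx i (η m) X := by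
    intro X hX
    have h1 := (hell X hX).1 (fun i => pdx i (η m) X)
    calc min lam 1 * gradxSq (η m) X ≤ lam * gradxSq (η m) X :=
          mul_le_mul_of_nonneg_right (min_le_left _ _) (gradxSq_nonneg _ _)
      _ ≤ _ := h1
      _ = _ := by
          simp only [hF, Finset.sum_mul]
  have hF2 : ∀ X ∈ UHS n, ∀ i, F i X ^ 2 ≤ Lam ^ 2 * gradSq (η m) X := by
    intro X hX i
    have h1 := (hell X hX).2 (fun i => pdx i (η m) X) (Pi.single i 1)
    have h2 : ∑ k, ∑ j, Bpar X k j * pdx j (η m) X * (Pi.single i (1:ℝ) : Fin (n-1) → ℝ) k = F i X := by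
      rw [Finset.sum_eq_single i]
      · simp [hF]
      · intro b _ hb; simp [hb]
      · simp
    have h3 : ∑ k, (Pi.single i (1:ℝ) : Fin (n-1) → ℝ) k ^ 2 = 1 := by
      rw [Finset.sum_eq_single i]
      · simp
      · intro b _ hb; simp [hb]
      · simp
    rw [h2, h3, Real.sqrt_one, mul_one] at h1
    calc F i X ^ 2 = |F i X| ^ 2 := (sq_abs _).symm
      _ ≤ (Lam * Real.sqrt (∑ i, pdx i (η m) X ^ 2)) ^ 2 := by gcongr
      _ = Lam ^ 2 * gradxSq (η m) X := by
          rw [mul_pow, Real.sq_sqrt (Finset.sum_nonneg fun j _ => sq_nonneg _)]; rfl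
      _ ≤ _ := by
          gcongr
          rw [gradSq_eq hn]; linarith [sq_nonneg (pdt (η m) X)]
  have hGP : ∀ X ∈ UHS n, ∑ i, G i X ^ 2 ≤ P X := by
    intro X _
    simp only [hP]
    rw [gradxA_sq, Finset.sum_mul]
    apply Finset.sum_le_sum
    intro i _
    refine (Finset.sum_mul_sq_le_sq_mul_sq _ _ _).trans ?_
    refine mul_le_mul_of_nonneg_right ?_ (Finset.sum_nonneg fun j _ => sq_nonneg _)
    apply Finset.sum_le_sum
    intro j _
    exact Finset.single_le_sum (f := fun m => pdx m (fun Y => Bpar Y i j) X ^ 2)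
      (fun j _ => sq_nonneg _) (Finset.mem_univ m)
  by_cases hPf : ∫⁻ X in UHS n, ENNReal.ofReal (P X * X.2) < ⊤
  swap
  · rw [not_lt_top_iff.1 hPf, ENNReal.mul_top]
    · exact le_top
    · simp only [ne_eq, ENNReal.ofReal_eq_zero, not_le]; positivity
  refine en_final hn hu hfe htr hl (min_le_right _ _) (sq_nonneg Lam) hFm hGm hPm hP0 hF1 hF2 hGP ?_
  intro φ hφ
  have hKF : ∀ i, MemLp (F i) 2 (volume.restrict (tsupport φ)) := by
    intro i
    have := en_H hn hu hfe htr hFm (G := fun _ _ => 0) (P := fun _ => 0) (fun i => aemeasurable_const)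
      aemeasurable_const hF2 (by simp) (by simp) (by simp) (some i) _ hφ.2.1 hφ.2.2
    simpa [HH] using this
  have hKG : ∀ i, MemLp (G i) 2 (volume.restrict (tsupport φ)) := by
    intro i
    have := en_H hn hu hfe htr (F := fun _ _ => 0) (Cf := 0) (fun i => measurable_const) hGm
      hPm (by simp) hGP hPf hP0 (some i) _ hφ.2.1 hφ.2.2
    simpa [HH] using this
  have hKt : MemLp (pdt (η m)) 2 (volume.restrict (tsupport φ)) :=
    en_H hn hu hfe htr (F := fun _ _ => 0) (Cf := 0) (fun i => measurable_const) hGm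
      hPm (by simp) hGP hPf hP0 none _ hφ.2.1 hφ.2.2
  have i1 : IntegrableOn (fun X => (∑ i, F i X * pdx i φ X) + pdt (η m) X * pdt φ X) (UHS n) :=
    Integrable.add (integrable_finsetSum _ fun i _ => integrable_test hφ (hKF i) _)
      (integrable_test hφ hKt _)
  have i2 : IntegrableOn (fun X => ∑ i, G i X * pdx i φ X) (UHS n) :=
    integrable_finsetSum _ fun i _ => integrable_test hφ (hKG i) _
  have hw := hweak φ hφ
  have e1 : (∫ X in UHS n, (∑ i : Fin (n - 1), ∑ j : Fin (n - 1),
          Bpar X i j * pdx j (η m) X * pdx i φ X) + pdt (η m) X * pdt φ X) =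
      ∫ X in UHS n, (∑ i, F i X * pdx i φ X) + pdt (η m) X * pdt φ X := by
    simp only [hF, Finset.sum_mul]
  have e2 : (∫ X in UHS n, ∑ i : Fin (n - 1), ∑ j : Fin (n - 1),
            pdx m (fun Z => Bpar Z i j) X * (v j X + η j X) * pdx i φ X) =
      ∫ X in UHS n, ∑ i, G i X * pdx i φ X := by
    simp only [hG, Finset.sum_mul]
  rw [e1, e2] at hw
  have e3 : (fun X => (∑ i, (F i X + G i X) * pdx i φ X) + pdt (η m) X * pdt φ X) =
      fun X => ((∑ i, F i X * pdx i φ X) + pdt (η m) X * pdt φ X) + ∑ i, G i X * pdx i φ X := by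
    ext X
    simp only [add_mul, Finset.sum_add_distrib]; ring
  rw [e3, integral_add i1 i2, hw]
  ring

/-- Bound for the right-hand side by the Carleson embedding. -/
lemma rhs_bound {n : ℕ} (hn : 2 ≤ n) {a : ℝ} (ha : 0 < a)
    {Bpar : Pt n → Fin (n - 1) → Fin (n - 1) → ℝ} {M : ℝ} {f : EE n → ℝ}
    {v η : Fin (n - 1) → Pt n → ℝ} (hset : WCSetup Bpar M f v η) :
    ∫⁻ X in UHS n, ENNReal.ofReal (gradxA Bpar X ^ 2 * (∑ j, (v j X + η j X) ^ 2) * X.2) ≤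
      2 * (ENNReal.ofReal M * (ENNReal.ofReal (((3 * kap a + 3) / kap a) ^ (n - 1)) *
        ((∑ j, ∫⁻ q, NT a (v j) q ^ 2) + ∑ j, ∫⁻ q, NT a (η j) q ^ 2))) := by
  obtain ⟨-, hcar, -, -, -, hv, hη⟩ := hset
  have hvc : ∀ j, ContinuousOn (v j) (UHS n) := fun j => contOn_of_diff (hv j).1.1
  have hηc : ∀ j, ContinuousOn (η j) (UHS n) := fun j => contOn_of_diff (hη j).1
  set κ := ENNReal.ofReal (((3 * kap a + 3) / kap a) ^ (n - 1))
  set ρ : Pt n → ℝ≥0∞ := fun X => ENNReal.ofReal (gradxA Bpar X ^ 2 * X.2) with hρ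
  have hρm : Measurable ρ :=
    (((measurable_gradxA Bpar).pow_const 2).mul measurable_snd).ennreal_ofReal
  have conv : ∀ w : Pt n → ℝ, ContinuousOn w (UHS n) →
      ∫⁻ X in UHS n, ρ X * ENNReal.ofReal (w X ^ 2) ≤ ENNReal.ofReal M * (κ * ∫⁻ q, NT a w q ^ 2) := by
    intro w hw
    have hwm : AEMeasurable (fun X => ENNReal.ofReal (w X ^ 2)) (volume.restrict (UHS n)) :=
      ((hw.aemeasurable (measurableSet_UHS n)).pow_const 2).ennreal_ofReal
    have h1 := carleson_embedding hn ha _ M hcar hw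
    unfold densM at h1
    rw [restrict_withDensity (measurableSet_UHS n),
      lintegral_withDensity_eq_lintegral_mul₀ hρm.aemeasurable
        (hwm)] at h1
    exact h1
  have hm : ∀ w : Pt n → ℝ, ContinuousOn w (UHS n) →
      AEMeasurable (fun X => ρ X * ENNReal.ofReal (w X ^ 2)) (volume.restrict (UHS n)) := fun w hw =>
    hρm.aemeasurable.mul ((hw.aemeasurable (measurableSet_UHS n)).pow_const 2).ennreal_ofReal
  calc _ ≤ ∫⁻ X in UHS n, 2 * ((∑ j, ρ X * ENNReal.ofReal (v j X ^ 2)) +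
          ∑ j, ρ X * ENNReal.ofReal (η j X ^ 2)) := by
        refine setLIntegral_mono_ae' (measurableSet_UHS n) (Eventually.of_forall fun X hX => ?_)
        have ht : 0 < X.2 := hX
        have h0 : 0 ≤ gradxA Bpar X ^ 2 * X.2 := by positivity
        simp only [hρ, ← ENNReal.ofReal_mul h0]
        rw [← ENNReal.ofReal_sum_of_nonneg (fun j _ => by positivity),
          ← ENNReal.ofReal_sum_of_nonneg (fun j _ => by positivity),
          ← ENNReal.ofReal_add (Finset.sum_nonneg fun j _ => by positivity)
            (Finset.sum_nonneg fun j _ => by positivity),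
          show (2:ℝ≥0∞) = ENNReal.ofReal 2 by simp, ← ENNReal.ofReal_mul (by norm_num)]
        apply ENNReal.ofReal_le_ofReal
        rw [← Finset.mul_sum, ← Finset.mul_sum, ← mul_add, ← Finset.sum_add_distrib]
        have h1 : ∑ j, (v j X + η j X) ^ 2 ≤ 2 * ∑ j, (v j X ^ 2 + η j X ^ 2) := by
          rw [Finset.mul_sum]
          apply Finset.sum_le_sum
          intro j _
          nlinarith [sq_nonneg (v j X - η j X)]
        calc _ = (gradxA Bpar X ^ 2 * X.2) * ∑ j, (v j X + η j X) ^ 2 := by ring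
          _ ≤ (gradxA Bpar X ^ 2 * X.2) * (2 * ∑ j, (v j X ^ 2 + η j X ^ 2)) := by gcongr
          _ = _ := by ring
    _ = 2 * ((∑ j, ∫⁻ X in UHS n, ρ X * ENNReal.ofReal (v j X ^ 2)) +
          ∑ j, ∫⁻ X in UHS n, ρ X * ENNReal.ofReal (η j X ^ 2)) := by
        rw [lintegral_const_mul' _ _ (by simp), lintegral_add_left'
          (Finset.aemeasurable_fun_sum _ fun j _ => hm _ (hvc j)),
          lintegral_finsetSum' _ (fun j _ => hm _ (hvc j)),
          lintegral_finsetSum' _ (fun j _ => hm _ (hηc j))]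
    _ ≤ 2 * ((∑ j, ENNReal.ofReal M * (κ * ∫⁻ q, NT a (v j) q ^ 2)) +
          ∑ j, ENNReal.ofReal M * (κ * ∫⁻ q, NT a (η j) q ^ 2)) := by
        gcongr with j _ j _
        · exact conv _ (hvc j)
        · exact conv _ (hηc j)
    _ = _ := by
        simp only [← Finset.mul_sum, ← mul_add]

lemma grad_trace_sum {d : ℕ} (f : EuclideanSpace ℝ (Fin d) → ℝ) :
    ∑ m, ∫⁻ q, (ENNReal.ofReal |pdE m f q|) ^ (2 : ℕ) =
      bLp 2 (fun q => ENNReal.ofReal (Real.sqrt (gradSqE f q))) ^ (2 : ℕ) := by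
  rw [bLp_sq, ← lintegral_finsetSum' _ (fun m _ => ?_)]
  · refine lintegral_congr fun q => ?_
    rw [← ENNReal.ofReal_pow (Real.sqrt_nonneg _),
      Real.sq_sqrt (show 0 ≤ gradSqE f q from Finset.sum_nonneg fun j _ => sq_nonneg _), gradSqE,
      ENNReal.ofReal_sum_of_nonneg (fun j _ => sq_nonneg _)]
    refine Finset.sum_congr rfl fun m _ => ?_
    rw [← ENNReal.ofReal_pow (abs_nonneg _), sq_abs]
  · have : Measurable (pdE m f) := measurable_fderiv_apply_const ℝ f _
    exact ((this.norm).ennreal_ofReal.pow_const 2).aemeasurable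


/-- **the square-function estimate (5.17)–(5.18).** For the
solution `η` of the weakly coupled system, assuming the `L²` Dirichlet problem
for `L` is solvable with constant `C_D`,
`Σ_m ‖S(η_m)‖²_{L²} ≤ C M (‖∇_x f‖²_{L²} + Σ_m ‖N(η_m)‖²_{L²})`. -/
theorem square_function_small_constant (n : ℕ) (hn : 2 ≤ n) (a : ℝ) (ha : 0 < a)
    (lam Lam CD : ℝ) (hlam : 0 < lam) (hLam : lam ≤ Lam) (hCD : 0 < CD) :
    ∃ C : ℝ, 0 < C ∧
      ∀ (Bpar : Pt n → Fin (n - 1) → Fin (n - 1) → ℝ) (M : ℝ)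
        (f : EE n → ℝ) (v η : Fin (n - 1) → Pt n → ℝ),
        EllipticOn (UHS n) Bpar lam Lam →
        WCSetup Bpar M f v η →
        (∀ m : Fin (n - 1),
          bLp 2 (NT a (v m)) ≤
            ENNReal.ofReal CD * bLp 2 (fun q => ENNReal.ofReal |pdE m f q|)) →
        (∑ m : Fin (n - 1), bLp 2 (SF a (gradSq (η m))) ^ (2 : ℕ)) ≤
          ENNReal.ofReal (C * M) *
            (bLp 2 (fun q => ENNReal.ofReal (Real.sqrt (gradSqE f q))) ^ (2 : ℕ) +
              ∑ m : Fin (n - 1), bLp 2 (NT a (η m)) ^ (2 : ℕ)) := by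
  have hk := kap_pos ha
  have hl : 0 < min lam 1 := lt_min hlam one_pos
  set V : ℝ := (volume (Metric.ball (0 : EE n) 1)).toReal with hV
  have hV0 : 0 ≤ V := ENNReal.toReal_nonneg
  have hVe : volume (Metric.ball (0 : EE n) 1) = ENNReal.ofReal V :=
    (ENNReal.ofReal_toReal measure_ball_lt_top.ne).symm
  set k1 : ℝ := kap a ^ (n - 1) * V with hk1
  set k2 : ℝ := 1 / (min lam 1) ^ 2 with hk2
  set k3 : ℝ := ((3 * kap a + 3) / kap a) ^ (n - 1) with hk3
  have h1 : 0 ≤ k1 := by positivity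
  have h2 : 0 ≤ k2 := by positivity
  have h3 : 0 ≤ k3 := by positivity
  set c0 : ℝ := ((n - 1 : ℕ) : ℝ) * (k1 * (k2 * (2 * k3))) with hc0
  have hc0' : 0 ≤ c0 := by positivity
  clear_value c0
  refine ⟨c0 * (CD ^ 2 + 1) + 1, by positivity, ?_⟩
  intro Bpar M f v η hell hset hD
  have hM : 0 ≤ M := (sq_nonneg _).trans (hset.2.2.1 ((0 : EE n), (1 : ℝ)) (by simp [UHS]))
  set A := bLp 2 (fun q => ENNReal.ofReal (Real.sqrt (gradSqE f q))) ^ (2 : ℕ) with hA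
  have hB : ∑ m : Fin (n - 1), bLp 2 (NT a (η m)) ^ (2 : ℕ) = ∑ j, ∫⁻ q, NT a (η j) q ^ 2 :=
    Finset.sum_congr rfl fun m _ => bLp_sq _
  rw [hB]
  set B := ∑ j, ∫⁻ q, NT a (η j) q ^ 2 with hBdef
  have hvA : ∑ j, ∫⁻ q, NT a (v j) q ^ 2 ≤ ENNReal.ofReal (CD ^ 2) * A := by
    rw [hA, ← grad_trace_sum, Finset.mul_sum]
    refine Finset.sum_le_sum fun m _ => ?_
    rw [← bLp_sq, ← bLp_sq, ENNReal.ofReal_pow hCD.le, ← mul_pow]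
    exact pow_le_pow_left' (hD m) 2
  have hm : ∀ m : Fin (n - 1), bLp 2 (SF a (gradSq (η m))) ^ (2 : ℕ) ≤
      ENNReal.ofReal (k1 * (k2 * (2 * k3))) * ENNReal.ofReal M *
        (ENNReal.ofReal (CD ^ 2) * A + B) := by
    intro m
    rw [SF_norm hn ha _ (measurable_gradSq (η m)), hVe,
      ← ENNReal.ofReal_mul (by positivity : 0 ≤ kap a ^ (n - 1))]
    have hr := (rhs_bound hn ha hset).trans
      (show _ ≤ 2 * (ENNReal.ofReal M * (ENNReal.ofReal k3 *
        (ENNReal.ofReal (CD ^ 2) * A + B))) by gcongr)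
    have he := (energy_component hn hlam hLam hell hset m).trans
      (mul_le_mul_right hr (ENNReal.ofReal k2))
    refine (mul_le_mul_right he (ENNReal.ofReal k1)).trans (le_of_eq ?_)
    · rw [ENNReal.ofReal_mul h1, ENNReal.ofReal_mul h2,
        ENNReal.ofReal_mul (by norm_num : (0:ℝ) ≤ 2), ENNReal.ofReal_ofNat]
      ring
  have hCD1 : ENNReal.ofReal (CD ^ 2) * A + B ≤ ENNReal.ofReal (CD ^ 2 + 1) * (A + B) := by
    rw [mul_add]
    refine add_le_add ?_ ?_
    · gcongr; linarith
    · calc B = 1 * B := (one_mul _).symm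
        _ ≤ _ := by
          gcongr
          rw [← ENNReal.ofReal_one]
          exact ENNReal.ofReal_le_ofReal (by nlinarith)
  calc ∑ m : Fin (n - 1), bLp 2 (SF a (gradSq (η m))) ^ (2 : ℕ)
      ≤ ∑ _m : Fin (n - 1), ENNReal.ofReal (k1 * (k2 * (2 * k3))) * ENNReal.ofReal M *
        (ENNReal.ofReal (CD ^ 2) * A + B) := Finset.sum_le_sum fun m _ => hm m
    _ = ENNReal.ofReal c0 * ENNReal.ofReal M * (ENNReal.ofReal (CD ^ 2) * A + B) := by
        rw [Finset.sum_const, Finset.card_univ, Fintype.card_fin, nsmul_eq_mul, hc0,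
          ENNReal.ofReal_mul (Nat.cast_nonneg _), ENNReal.ofReal_natCast]
        ring
    _ ≤ ENNReal.ofReal c0 * ENNReal.ofReal M * (ENNReal.ofReal (CD ^ 2 + 1) * (A + B)) := by
        gcongr
    _ = ENNReal.ofReal (c0 * (CD ^ 2 + 1) * M) * (A + B) := by
        rw [ENNReal.ofReal_mul (by positivity : 0 ≤ c0 * (CD ^ 2 + 1)), ENNReal.ofReal_mul hc0']
        ring
    _ ≤ _ := by
        gcongr
        linarith

end
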